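/- There exist d ≥ 2, an irreducible permutation π of {1,…,d}, and a length vector L with strictly positive entries summing to 1, such that the interval exchange transformation T_{L,π}: [0,1) → [0,1) is topologically mixing and uniquely ergodic, i.e., there is exactly one T_{L,π}-invariant Borel probability measure on [0,1) (namely Lebesgue measure). -/

import Mathlib

open Finset MeasureTheory

namespace IETPaper

/-- The first index `0` of `Fin d` (corresponding to `1` in `{1,…,d}`). -/
def firstIdx (d : ℕ) [NeZero d] : Fin d := ⟨0, Nat.pos_of_ne_zero (NeZero.ne d)⟩

/-- The last index `d-1` of `Fin d` (corresponding to `d` in `{1,…,d}`). -/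
def lastIdx (d : ℕ) [NeZero d] : Fin d :=
  ⟨d - 1, Nat.sub_lt (Nat.pos_of_ne_zero (NeZero.ne d)) one_pos⟩

/-- Left endpoint `l₁ + ⋯ + l_{j-1}` of the `j`-th interval `I_j`. -/
noncomputable def leftEnd {d : ℕ} (L : Fin d → ℝ) (j : Fin d) : ℝ :=
  ∑ k ∈ Finset.univ.filter (fun k => k < j), L k

/-- The interval exchange transformation `T_{L,π}`: on the interval
`I_j = [leftEnd L j, leftEnd L j + L j)` it is the translation
`x ↦ x - ∑_{k < j} l_k + ∑_{π k' < π j} l_{k'}`; elsewhere it is the identity. -/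
noncomputable def ietMap {d : ℕ} (π : Equiv.Perm (Fin d)) (L : Fin d → ℝ) (x : ℝ) : ℝ :=
  if h : ∃ j : Fin d, x ∈ Set.Ico (leftEnd L j) (leftEnd L j + L j) then
    x - leftEnd L h.choose + ∑ k ∈ Finset.univ.filter (fun k => π k < π h.choose), L k
  else x

/-- Topological mixing of `T` on the subspace `X ⊆ ℝ` (with its subspace topology:
open sets of `X` are exactly the sets `U ∩ X` with `U` open in `ℝ`). -/
def TopMixingOn (T : ℝ → ℝ) (X : Set ℝ) : Prop :=
  ∀ U V : Set ℝ, IsOpen U → IsOpen V → (U ∩ X).Nonempty → (V ∩ X).Nonempty →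
    ∃ N : ℕ, ∀ n : ℕ, N ≤ n → ((T^[n] '' (U ∩ X)) ∩ (V ∩ X)).Nonempty

/-- Irreducibility of a permutation: `π {1,…,k} ≠ {1,…,k}` for all `k < d`
(0-indexed: `π` does not preserve `{j | j < k}` for `0 < k < d`). -/
def IsIrreducible {d : ℕ} (π : Equiv.Perm (Fin d)) : Prop :=
  ∀ k : ℕ, 0 < k → k < d →
    (⇑π '' {j : Fin d | (j : ℕ) < k}) ≠ {j : Fin d | (j : ℕ) < k}

/-- A permutation of `{1,…,d}` (written 0-indexed on `Fin d`) is degenerate if for some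
`1 ≤ j < d` (0-indexed: `j + 1 < d`) one of the four listed conditions holds. -/
def IsDegenerate {d : ℕ} (π : Equiv.Perm (Fin d)) : Prop :=
  ∃ j : ℕ, ∃ hj : j + 1 < d,
    ((π ⟨j + 1, hj⟩ : ℕ) = (π ⟨j, by omega⟩ : ℕ) + 1) ∨
    ((π ⟨j, by omega⟩ : ℕ) = d - 1 ∧ (π ⟨j + 1, hj⟩ : ℕ) = 0 ∧
      (π ⟨0, by omega⟩ : ℕ) = (π ⟨d - 1, by omega⟩ : ℕ) + 1) ∨
    ((π ⟨j + 1, hj⟩ : ℕ) = 0 ∧ (π ⟨0, by omega⟩ : ℕ) = (π ⟨j, by omega⟩ : ℕ) + 1) ∨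
    ((π ⟨j + 1, hj⟩ : ℕ) = (π ⟨d - 1, by omega⟩ : ℕ) + 1 ∧ (π ⟨j, by omega⟩ : ℕ) = d - 1)

/-- The Keane condition (idoc): the forward orbits of the interior discontinuities
`δ_i = leftEnd L i` (`i ≠ 0`) are pairwise disjoint infinite sets. -/
def KeaneCondition {d : ℕ} (π : Equiv.Perm (Fin d)) (L : Fin d → ℝ) : Prop :=
  ∀ i j : Fin d, (i : ℕ) ≠ 0 → (j : ℕ) ≠ 0 → ∀ m n : ℕ,
    (ietMap π L)^[m] (leftEnd L i) = (ietMap π L)^[n] (leftEnd L j) → i = j ∧ m = n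

/-- `w` is an allowed block for `T_{L,π}`: some point `x` satisfies
`T^{i+1} x ∈ I_{w i}` for all positions `i` of `w` (i.e. `x ∈ ⋂ T^{-i} I_{a_i}`). -/
def IsAllowedBlock {d : ℕ} (π : Equiv.Perm (Fin d)) (L : Fin d → ℝ)
    (w : List (Fin d)) : Prop :=
  ∃ x : ℝ, ∀ (i : ℕ) (hi : i < w.length),
    (ietMap π L)^[i + 1] x ∈
      Set.Ico (leftEnd L (w.get ⟨i, hi⟩)) (leftEnd L (w.get ⟨i, hi⟩) + L (w.get ⟨i, hi⟩))

/-- `k`-alphabet mixing: there is `N` such that for any two allowed `k`-blocks `u, v`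
and any `n > N` there is an allowed `n`-block beginning with `u` and ending with `v`. -/
def AlphabetMixing {d : ℕ} (π : Equiv.Perm (Fin d)) (L : Fin d → ℝ) (k : ℕ) : Prop :=
  ∃ N : ℕ, ∀ u v : List (Fin d), u.length = k → v.length = k →
    IsAllowedBlock π L u → IsAllowedBlock π L v →
    ∀ n : ℕ, N < n → ∃ w : List (Fin d),
      w.length = n ∧ IsAllowedBlock π L w ∧ u <+: w ∧ v <:+ w

/-- `π'` is obtained from `π` by the Rauzy move of type `a`. -/
def RauzyMoveA {d : ℕ} [NeZero d] (π π' : Equiv.Perm (Fin d)) : Prop :=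
  ∀ j : Fin d,
    ((j : ℕ) ≤ (π.symm (lastIdx d) : ℕ) → π' j = π j) ∧
    ((j : ℕ) = (π.symm (lastIdx d) : ℕ) + 1 → π' j = π (lastIdx d)) ∧
    ((π.symm (lastIdx d) : ℕ) + 1 < (j : ℕ) →
      π' j = π ⟨(j : ℕ) - 1, lt_of_le_of_lt (Nat.sub_le _ _) j.isLt⟩)

/-- `π'` is obtained from `π` by the Rauzy move of type `b`. -/
def RauzyMoveB {d : ℕ} [NeZero d] (π π' : Equiv.Perm (Fin d)) : Prop :=
  ∀ j : Fin d,
    ((π j : ℕ) ≤ (π (lastIdx d) : ℕ) → π' j = π j) ∧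
    ((π (lastIdx d) : ℕ) < (π j : ℕ) → (π j : ℕ) < d - 1 →
      (π' j : ℕ) = (π j : ℕ) + 1) ∧
    ((π j : ℕ) = d - 1 → (π' j : ℕ) = (π (lastIdx d) : ℕ) + 1)

/-- `π` is in the Rauzy class of `π₀`: reachable by finitely many moves `a`, `b`. -/
def InRauzyClass {d : ℕ} [NeZero d] (π₀ π : Equiv.Perm (Fin d)) : Prop :=
  Relation.ReflTransGen (fun p q => RauzyMoveA p q ∨ RauzyMoveB p q) π₀ π

/-- The permutation `(4321)` on `{1,2,3,4}` (0-indexed: `j ↦ 3 - j`). -/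
def perm4321 : Equiv.Perm (Fin 4) := ⟨![3, 2, 1, 0], ![3, 2, 1, 0], by decide, by decide⟩

/-- The permutation `(4213)` on `{1,2,3,4}`: `1↦4, 2↦2, 3↦1, 4↦3`. -/
def perm4213 : Equiv.Perm (Fin 4) := ⟨![3, 1, 0, 2], ![2, 1, 3, 0], by decide, by decide⟩

/-- The combinatorial data of an interval exchange transformation:
a permutation together with a length vector. -/
structure IET (d : ℕ) where
  perm : Equiv.Perm (Fin d)
  len : Fin d → ℝ

/-- The first step of Rauzy induction on `T` is of type `a`, i.e.
`δ_max = δ_+` (equivalently `l_d < l_{π⁻¹ d}`). -/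
def stepA {d : ℕ} [NeZero d] (T : IET d) : Prop :=
  T.len (lastIdx d) < T.len (T.perm.symm (lastIdx d))

/-- The first step of Rauzy induction on `T` is of type `b`, i.e.
`δ_max = δ_-` (equivalently `l_{π⁻¹ d} < l_d`). -/
def stepB {d : ℕ} [NeZero d] (T : IET d) : Prop :=
  T.len (T.perm.symm (lastIdx d)) < T.len (lastIdx d)

/-- The length vector of `R(T)` after a type `a` step (the first return map of `T`
to `[0, δ_+)`, with intervals in their natural order). -/
noncomputable def lenAfterA {d : ℕ} [NeZero d] (π : Equiv.Perm (Fin d))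
    (L : Fin d → ℝ) : Fin d → ℝ := fun j =>
  if (j : ℕ) < (π.symm (lastIdx d) : ℕ) then L j
  else if (j : ℕ) = (π.symm (lastIdx d) : ℕ) then L j - L (lastIdx d)
  else if (j : ℕ) = (π.symm (lastIdx d) : ℕ) + 1 then L (lastIdx d)
  else L ⟨(j : ℕ) - 1, lt_of_le_of_lt (Nat.sub_le _ _) j.isLt⟩

/-- The length vector of `R(T)` after a type `b` step (the first return map of `T`
to `[0, δ_-)`). -/
noncomputable def lenAfterB {d : ℕ} [NeZero d] (π : Equiv.Perm (Fin d))
    (L : Fin d → ℝ) : Fin d → ℝ := fun j =>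
  if j = lastIdx d then L j - L (π.symm (lastIdx d)) else L j

/-- `T'` is the result of one step of Rauzy induction applied to `T`
(`T' = R(T)`, un-rescaled). -/
def IsRauzyStep {d : ℕ} [NeZero d] (T T' : IET d) : Prop :=
  (stepA T ∧ RauzyMoveA T.perm T'.perm ∧ T'.len = lenAfterA T.perm T.len) ∨
  (stepB T ∧ RauzyMoveB T.perm T'.perm ∧ T'.len = lenAfterB T.perm T.len)

/-- The matrix `M(T,1)` of a type `a` step. -/
def matA {d : ℕ} [NeZero d] (π : Equiv.Perm (Fin d)) : Matrix (Fin d) (Fin d) ℤ :=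
  Matrix.of fun i j =>
    if (j : ℕ) ≤ (π.symm (lastIdx d) : ℕ) then (if i = j then 1 else 0)
    else if i = lastIdx d then (if (j : ℕ) = (π.symm (lastIdx d) : ℕ) + 1 then 1 else 0)
    else if (i : ℕ) = (j : ℕ) - 1 then 1 else 0

/-- The matrix `M(T,1)` of a type `b` step. -/
def matB {d : ℕ} [NeZero d] (π : Equiv.Perm (Fin d)) : Matrix (Fin d) (Fin d) ℤ :=
  Matrix.of fun i j =>
    if i = lastIdx d ∧ j = π.symm (lastIdx d) then 1 else if i = j then 1 else 0

open Classical in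
/-- The matrix `M(T,1)` of the first step of Rauzy induction on `T`. -/
noncomputable def stepMat {d : ℕ} [NeZero d] (T : IET d) : Matrix (Fin d) (Fin d) ℤ :=
  if stepA T then matA T.perm else matB T.perm

/-- A run of `n` steps of Rauzy induction: `seq 0 = T`, `seq (i+1) = R(seq i)`
for `i < n`.  `T` admits `n` steps of Rauzy induction iff such a chain starting
at `T` exists. -/
structure RauzyChain (d : ℕ) [NeZero d] (n : ℕ) where
  seq : ℕ → IET d
  step : ∀ i, i < n → IsRauzyStep (seq i) (seq (i + 1))

/-- The matrix `M(R^a(T), m)` of the steps `a, a+1, …, a+m-1` of a chain. -/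
noncomputable def chainMatrixFrom {d n : ℕ} [NeZero d] (c : RauzyChain d n)
    (a m : ℕ) : Matrix (Fin d) (Fin d) ℤ :=
  ((List.range m).map fun i => stepMat (c.seq (a + i))).prod

/-- The matrix `M(T, m)` of the first `m` steps of a chain starting at `T`. -/
noncomputable def chainMatrix {d n : ℕ} [NeZero d] (c : RauzyChain d n)
    (m : ℕ) : Matrix (Fin d) (Fin d) ℤ :=
  chainMatrixFrom c 0 m

/-- `|C_j(M)|`, the sum of the entries of the `j`-th column of `M`. -/
def colSum {d : ℕ} (M : Matrix (Fin d) (Fin d) ℤ) (j : Fin d) : ℤ := ∑ i, M i j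

/-- `M_Δ = M ℝ₊^d ∩ Δ̊_{d-1}`: positive vectors of the cone of `M` lying in the
interior of the standard simplex. -/
def matSimplex {d : ℕ} (M : Matrix (Fin d) (Fin d) ℤ) : Set (Fin d → ℝ) :=
  {L | (∃ v : Fin d → ℝ, (∀ i, 0 ≤ v i) ∧ L = (M.map (Int.cast : ℤ → ℝ)).mulVec v) ∧
       (∀ i, 0 < L i) ∧ ∑ i, L i = 1}

/-- `u^n`, the `n`-fold concatenation of the word `u` with itself. -/
def wpow {α : Type*} (u : List α) (n : ℕ) : List α := (List.replicate n u).flatten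

/-- Membership of `u` in the interval from `p` to `q`, closed on the left if `b` is true
and closed on the right otherwise. -/
def MemSided (b : Bool) (p q u : ℝ) : Prop :=
  if b then p ≤ u ∧ u < q else p < u ∧ u ≤ q

theorem MemSided.mono {b : Bool} {p q p' q' u : ℝ} (h : MemSided b p q u) (hp : p' ≤ p)
    (hq : q ≤ q') : MemSided b p' q' u := by
  cases b <;> simp only [MemSided] at * <;> constructor <;> simp at h <;> linarith

theorem MemSided.add {b : Bool} {p q u : ℝ} (h : MemSided b p q u) (t : ℝ) :
    MemSided b (p + t) (q + t) (u + t) := by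
  cases b <;> simpa [MemSided] using h

theorem MemSided.reflect {b : Bool} {p q u : ℝ} (h : MemSided b p q u) (c : ℝ) :
    MemSided (!b) (c - q) (c - p) (c - u) := by
  cases b <;> simp [MemSided] at * <;> constructor <;> linarith

theorem MemSided.split {b : Bool} {p r u : ℝ} (h : MemSided b p r u) (q : ℝ) :
    MemSided b p q u ∨ MemSided b q r u := by
  cases b
  · rcases le_or_gt u q with hq | hq <;> simp_all [MemSided]
  · rcases lt_or_ge u q with hq | hq <;> simp_all [MemSided]

theorem MemSided.lt {b : Bool} {p q u : ℝ} (h : MemSided b p q u) : p < q := by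
  cases b <;> simp [MemSided] at h <;> linarith

theorem MemSided.bounds {b : Bool} {p q u : ℝ} (h : MemSided b p q u) : p ≤ u ∧ u ≤ q := by
  cases b <;> simp [MemSided] at h <;> constructor <;> linarith

theorem MemSided.disjoint {b : Bool} {p q p' q' u : ℝ} (h : MemSided b p q u)
    (h' : MemSided b p' q' u) : p < q' := by
  cases b <;> simp [MemSided] at h h' <;> linarith

theorem MemSided.exists_block {b : Bool} {p w u : ℝ} (N : ℕ)
    (h : MemSided b p (p + N * w) u) :
    ∃ j < N, MemSided b (p + j * w) (p + (j + 1) * w) u := by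
  induction N with
  | zero => exact absurd h.lt (by simp)
  | succ N ih =>
    rcases h.split (p + N * w) with h | h
    · obtain ⟨j, hj, h⟩ := ih h
      exact ⟨j, by omega, h⟩
    · exact ⟨N, by omega, by simpa using h⟩

/-- The orientation sign attached to a side. -/
def sideSign (b : Bool) : ℝ := if b then 1 else -1

theorem sideSign_not (b : Bool) : sideSign (!b) = -sideSign b := by
  cases b <;> simp [sideSign]

theorem abs_sideSign (b : Bool) : |sideSign b| = 1 := by
  cases b <;> simp [sideSign]

/-- The point with oriented coordinate `u` relative to the origin `a`. -/
def chart (a : ℝ) (b : Bool) (u : ℝ) : ℝ := a + sideSign b * u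

theorem chart_reflect (a : ℝ) (b : Bool) (c u : ℝ) :
    chart (a + sideSign b * c) (!b) u = chart a b (c - u) := by
  simp only [chart, sideSign_not]; ring

theorem chart_injective (a : ℝ) (b : Bool) : Function.Injective (chart a b) := by
  intro u v h
  cases b <;> simpa [chart, sideSign] using h

/-- The orbits of the points with coordinates `u` and `v` stay parallel for `H` steps, after
which both coordinates have been translated by `t`. -/
def ParallelMove (T : ℝ → ℝ) (a : ℝ) (b : Bool) (u v : ℝ) (H : ℕ) (t : ℝ) : Prop :=
  (∀ s ≤ H, T^[s] (chart a b u) - T^[s] (chart a b v) = chart a b u - chart a b v) ∧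
    T^[H] (chart a b u) = chart a b (u + t) ∧ T^[H] (chart a b v) = chart a b (v + t)

theorem ParallelMove.refl (T : ℝ → ℝ) (a : ℝ) (b : Bool) (u v : ℝ) :
    ParallelMove T a b u v 0 0 := by
  refine ⟨fun s hs => ?_, by simp, by simp⟩
  obtain rfl : s = 0 := by omega
  rfl

theorem ParallelMove.trans {T : ℝ → ℝ} {a : ℝ} {b : Bool} {u v t t' : ℝ} {H H' : ℕ}
    (h : ParallelMove T a b u v H t) (h' : ParallelMove T a b (u + t) (v + t) H' t') :
    ParallelMove T a b u v (H + H') (t + t') := by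
  obtain ⟨h1, h2, h3⟩ := h
  obtain ⟨h1', h2', h3'⟩ := h'
  refine ⟨fun s hs => ?_, ?_, ?_⟩
  · rcases le_total s H with hs' | hs'
    · exact h1 s hs'
    · obtain ⟨r, rfl⟩ := Nat.exists_eq_add_of_le hs'
      rw [add_comm H r, Function.iterate_add_apply, Function.iterate_add_apply, h2, h3,
        h1' r (by omega)]
      simp only [chart]; ring
  · rw [add_comm H H', Function.iterate_add_apply, h2, h2', add_assoc]
  · rw [add_comm H H', Function.iterate_add_apply, h3, h3', add_assoc]

/-- Left ends (in oriented coordinates) of the four intervals with lengths `l`. -/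
def startCoord (l : Fin 4 → ℝ) : Fin 4 → ℝ := ![0, l 0, l 0 + l 1, l 0 + l 1 + l 2]

/-- Translations realising the exchange of the order `1 2 3 4` into the order `4 2 1 3`. -/
def shiftCoord (l : Fin 4 → ℝ) : Fin 4 → ℝ :=
  ![l 3 + l 1, l 3 - l 0, l 3, -(l 0 + l 1 + l 2)]

/-- The total length. -/
def totalLen (l : Fin 4 → ℝ) : ℝ := l 0 + l 1 + l 2 + l 3

/-- Membership of the coordinate `u` in the `i`-th interval. -/
def MemPiece (b : Bool) (l : Fin 4 → ℝ) (i : Fin 4) (u : ℝ) : Prop :=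
  MemSided b (startCoord l i) (startCoord l i + l i) u

/-- `T` induces, on the interval with origin `a`, orientation `b` and pieces of lengths `l`,
the exchange `1 2 3 4 → 4 2 1 3` with return times `h`, and the associated towers cover
`[0, 1)`. -/
structure IsRenormalization (T : ℝ → ℝ) (a : ℝ) (b : Bool) (l : Fin 4 → ℝ)
    (h : Fin 4 → ℕ) : Prop where
  move : ∀ i u v, MemPiece b l i u → MemPiece b l i v →
    ParallelMove T a b u v (h i) (shiftCoord l i)
  cover : ∀ x ∈ Set.Ico (0 : ℝ) 1, ∃ i u s, MemPiece b l i u ∧ s < h i ∧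
    T^[s] (chart a b u) = x
  inside : ∀ u, MemSided b 0 (totalLen l) u → chart a b u ∈ Set.Ico (0 : ℝ) 1

theorem IsRenormalization.move_iterate {T : ℝ → ℝ} {a : ℝ} {b : Bool} {l : Fin 4 → ℝ}
    {h : Fin 4 → ℕ} (R : IsRenormalization T a b l h) (i : Fin 4) (u v : ℝ) (s : ℕ)
    (hu : ∀ r < s, MemPiece b l i (u + r * shiftCoord l i))
    (hv : ∀ r < s, MemPiece b l i (v + r * shiftCoord l i)) :
    ParallelMove T a b u v (s * h i) (s * shiftCoord l i) := by
  induction s with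
  | zero => simpa using ParallelMove.refl T a b u v
  | succ s ih =>
    have h1 := ih (fun r hr => hu r (by omega)) (fun r hr => hv r (by omega))
    have h2 := h1.trans (R.move i _ _ (hu s (by omega)) (hv s (by omega)))
    convert h2 using 1
    · ring
    · push_cast; ring

/-- The length vector `l` is the image of `l'` under Keane's matrix with parameters
`m + 1` and `n + 1`. -/
def IsKeaneStep (m n : ℕ) (l l' : Fin 4 → ℝ) : Prop :=
  l 0 = l' 2 + l' 3 ∧ l 1 = m * l' 0 + (m + 1) * l' 1 ∧
    l 2 = n * totalLen l' + (l' 0 + l' 1 + l' 3) ∧ l 3 = totalLen l'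

/-- Time spent outside the third interval by a return to the fourth interval. -/
def prefixTime (m : ℕ) (h : Fin 4 → ℕ) : Fin 4 → ℕ :=
  ![h 3 + m * h 1, h 3 + (m + 1) * h 1, h 3 + h 0, h 3 + h 0]

/-- Number of visits to the third interval of a return to the fourth interval. -/
def thirdVisits (n : ℕ) : Fin 4 → ℕ := ![n + 1, n + 1, n, n + 1]

/-- Return times to the fourth interval. -/
def nextTime (m n : ℕ) (h : Fin 4 → ℕ) (i : Fin 4) : ℕ :=
  prefixTime m h i + thirdVisits n i * h 2

/-- Translation accomplished during the time `prefixTime`. -/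
def prefixShift (m : ℕ) (l : Fin 4 → ℝ) : Fin 4 → ℝ :=
  ![shiftCoord l 3 + m * shiftCoord l 1, shiftCoord l 3 + (m + 1 : ℕ) * shiftCoord l 1,
    shiftCoord l 3 + shiftCoord l 0, shiftCoord l 3 + shiftCoord l 0]

section Step

variable {T : ℝ → ℝ} {a : ℝ} {b : Bool} {l l' : Fin 4 → ℝ} {h : Fin 4 → ℕ} {m n : ℕ}

theorem MemPiece.mem_total (hl : ∀ i, 0 < l i) {i : Fin 4} {u : ℝ} (hu : MemPiece b l i u) :
    MemSided b 0 (totalLen l) u := by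
  have h0 := hl 0; have h1 := hl 1; have h2 := hl 2; have h3 := hl 3
  refine MemSided.mono hu ?_ ?_ <;> fin_cases i <;> simp [startCoord, totalLen] <;> linarith

theorem exists_memPiece {u : ℝ} (hu : MemSided b 0 (totalLen l) u) :
    ∃ i, MemPiece b l i u := by
  rcases hu.split (l 0) with h0 | hu
  · exact ⟨0, by simpa [MemPiece, startCoord] using h0⟩
  rcases hu.split (l 0 + l 1) with h0 | hu
  · exact ⟨1, by simpa [MemPiece, startCoord] using h0⟩
  rcases hu.split (l 0 + l 1 + l 2) with h0 | hu
  · exact ⟨2, by simpa [MemPiece, startCoord] using h0⟩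
  · exact ⟨3, by simpa [MemPiece, startCoord, totalLen] using hu⟩

theorem memPiece_three_reflect (hk : IsKeaneStep m n l l') {u : ℝ}
    (hu : MemSided (!b) 0 (totalLen l') u) : MemPiece b l 3 (totalLen l - u) := by
  obtain ⟨-, -, -, h3⟩ := hk
  have := hu.reflect (totalLen l)
  rw [Bool.not_not] at this
  refine this.mono ?_ ?_ <;> simp [startCoord, totalLen] at * <;> linarith

theorem memPiece_zero_of (hk : IsKeaneStep m n l l') (hl' : ∀ i, 0 < l' i) {i : Fin 4}
    (hi : i = 2 ∨ i = 3) {u : ℝ} (hu : MemPiece (!b) l' i u) :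
    MemPiece b l 0 (totalLen l - u + shiftCoord l 3) := by
  obtain ⟨e0, e1, e2, e3⟩ := hk
  have h0 := hl' 0; have h1 := hl' 1; have h2 := hl' 2; have h3 := hl' 3
  have := (MemSided.reflect hu (totalLen l)).add (shiftCoord l 3)
  rw [Bool.not_not] at this
  refine this.mono ?_ ?_ <;> rcases hi with rfl | rfl <;>
    simp [startCoord, totalLen, shiftCoord] at * <;> linarith

theorem memPiece_one_of (hk : IsKeaneStep m n l l') (hl' : ∀ i, 0 < l' i) {i : Fin 4} {s : ℕ}
    (hi : i = 0 ∧ s < m ∨ i = 1 ∧ s < m + 1) {u : ℝ} (hu : MemPiece (!b) l' i u) :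
    MemPiece b l 1 (totalLen l - u + shiftCoord l 3 + s * shiftCoord l 1) := by
  obtain ⟨e0, e1, e2, e3⟩ := hk
  have h0 := hl' 0; have h1 := hl' 1; have h2 := hl' 2; have h3 := hl' 3
  have := ((MemSided.reflect hu (totalLen l)).add (shiftCoord l 3)).add (s * shiftCoord l 1)
  rw [Bool.not_not] at this
  have hw : shiftCoord l 1 = l' 0 + l' 1 := by
    simp [shiftCoord, totalLen] at *; linarith
  have hs0 : (0 : ℝ) ≤ s * (l' 0 + l' 1) := by positivity
  refine this.mono ?_ ?_ <;> rw [hw] <;> rcases hi with ⟨rfl, hs⟩ | ⟨rfl, hs⟩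
  · simp [startCoord, totalLen, shiftCoord] at *; linarith
  · simp [startCoord, totalLen, shiftCoord] at *; linarith
  · have : (s : ℝ) + 1 ≤ m := by exact_mod_cast hs
    have : (s + 1) * (l' 0 + l' 1) ≤ m * (l' 0 + l' 1) := by gcongr
    simp [startCoord, totalLen, shiftCoord] at *; linarith
  · have : (s : ℝ) ≤ m := by exact_mod_cast Nat.lt_succ_iff.mp hs
    have : s * (l' 0 + l' 1) ≤ m * (l' 0 + l' 1) := by gcongr
    simp [startCoord, totalLen, shiftCoord] at *; linarith

theorem memPiece_two_of (hk : IsKeaneStep m n l l') (hl' : ∀ i, 0 < l' i) {i : Fin 4} {j : ℕ}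
    (hj : j < thirdVisits n i) {u : ℝ} (hu : MemPiece (!b) l' i u) :
    MemPiece b l 2 (totalLen l - u + prefixShift m l i + j * shiftCoord l 2) := by
  obtain ⟨e0, e1, e2, e3⟩ := hk
  have h0 := hl' 0; have h1 := hl' 1; have h2 := hl' 2; have h3 := hl' 3
  have := ((MemSided.reflect hu (totalLen l)).add (prefixShift m l i)).add
    (j * shiftCoord l 2)
  rw [Bool.not_not] at this
  have hw : shiftCoord l 2 = totalLen l' := e3
  have hS : 0 < totalLen l' := by simp [totalLen]; linarith
  have hs0 : (0 : ℝ) ≤ j * totalLen l' := by positivity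
  have hjn : (j : ℝ) * totalLen l' + (if i = 2 then totalLen l' else 0) ≤
      n * totalLen l' := by
    split_ifs with hi
    · subst hi
      have : (j : ℝ) + 1 ≤ n := by exact_mod_cast hj
      nlinarith
    · have : (j : ℝ) ≤ n := by
        fin_cases i <;> simp [thirdVisits] at hj hi ⊢ <;> omega
      simp; gcongr
  refine this.mono ?_ ?_ <;> rw [hw] <;> generalize (j : ℝ) * totalLen l' = x at * <;>
    generalize (n : ℝ) * totalLen l' = y at * <;>
    fin_cases i <;>
    simp [startCoord, totalLen, shiftCoord, prefixShift] at * <;>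
    simp only [e0, e1, e2, e3] <;> linarith

theorem prefix_move (R : IsRenormalization T a b l h) (hk : IsKeaneStep m n l l')
    (hl' : ∀ i, 0 < l' i) {i : Fin 4} {u v : ℝ} (hu : MemPiece (!b) l' i u)
    (hv : MemPiece (!b) l' i v) :
    ParallelMove T a b (totalLen l - u) (totalLen l - v) (prefixTime m h i)
      (prefixShift m l i) := by
  have hfirst := R.move 3 _ _ (memPiece_three_reflect hk (hu.mem_total hl'))
    (memPiece_three_reflect hk (hv.mem_total hl'))
  fin_cases i
  · exact hfirst.trans (R.move_iterate 1 _ _ m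
      (fun r hr => memPiece_one_of hk hl' (.inl ⟨rfl, hr⟩) hu)
      (fun r hr => memPiece_one_of hk hl' (.inl ⟨rfl, hr⟩) hv))
  · exact hfirst.trans (R.move_iterate 1 _ _ (m + 1)
      (fun r hr => memPiece_one_of hk hl' (.inr ⟨rfl, hr⟩) hu)
      (fun r hr => memPiece_one_of hk hl' (.inr ⟨rfl, hr⟩) hv))
  · exact hfirst.trans (R.move 0 _ _ (memPiece_zero_of hk hl' (.inl rfl) hu)
      (memPiece_zero_of hk hl' (.inl rfl) hv))
  · exact hfirst.trans (R.move 0 _ _ (memPiece_zero_of hk hl' (.inr rfl) hu)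
      (memPiece_zero_of hk hl' (.inr rfl) hv))

theorem third_move (R : IsRenormalization T a b l h) (hk : IsKeaneStep m n l l')
    (hl' : ∀ i, 0 < l' i) {i : Fin 4} {j : ℕ} (hj : j ≤ thirdVisits n i) {u v : ℝ}
    (hu : MemPiece (!b) l' i u) (hv : MemPiece (!b) l' i v) :
    ParallelMove T a b (totalLen l - u) (totalLen l - v) (prefixTime m h i + j * h 2)
      (prefixShift m l i + j * shiftCoord l 2) :=
  (prefix_move R hk hl' hu hv).trans (R.move_iterate 2 _ _ j
    (fun _ hr => memPiece_two_of hk hl' (hr.trans_le hj) hu)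
    (fun _ hr => memPiece_two_of hk hl' (hr.trans_le hj) hv))

theorem second_move (R : IsRenormalization T a b l h) (hk : IsKeaneStep m n l l')
    (hl' : ∀ i, 0 < l' i) {i : Fin 4} {s : ℕ} (hi : i = 0 ∧ s ≤ m ∨ i = 1 ∧ s ≤ m + 1)
    {u v : ℝ} (hu : MemPiece (!b) l' i u) (hv : MemPiece (!b) l' i v) :
    ParallelMove T a b (totalLen l - u) (totalLen l - v) (h 3 + s * h 1)
      (shiftCoord l 3 + s * shiftCoord l 1) :=
  (R.move 3 _ _ (memPiece_three_reflect hk (hu.mem_total hl'))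
    (memPiece_three_reflect hk (hv.mem_total hl'))).trans (R.move_iterate 1 _ _ s
    (fun r hr => memPiece_one_of hk hl' (by omega) hu)
    (fun r hr => memPiece_one_of hk hl' (by omega) hv))

theorem ParallelMove.reflect {c u v t : ℝ} {H : ℕ}
    (p : ParallelMove T a b (c - u) (c - v) H (-t)) :
    ParallelMove T (a + sideSign b * c) (!b) u v H t := by
  obtain ⟨h1, h2, h3⟩ := p
  simp only [ParallelMove, chart_reflect]
  refine ⟨h1, ?_, ?_⟩
  · rw [h2]; congr 1; ring
  · rw [h3]; congr 1; ring

theorem prefixShift_add (hk : IsKeaneStep m n l l') (i : Fin 4) :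
    prefixShift m l i + thirdVisits n i * shiftCoord l 2 = -shiftCoord l' i := by
  obtain ⟨e0, e1, e2, e3⟩ := hk
  fin_cases i <;> simp [prefixShift, thirdVisits, shiftCoord, e0, e1, e2, e3, totalLen] <;> ring

theorem exists_memPiece_zero (hk : IsKeaneStep m n l l') {u : ℝ}
    (hu : MemSided b (startCoord l 0) (startCoord l 0 + l 0) u) :
    ∃ i, (i = 2 ∨ i = 3) ∧ MemPiece (!b) l' i (l 3 - u) := by
  obtain ⟨e0, e1, e2, e3⟩ := hk
  have := hu.reflect (l 3)
  rcases this.split (l' 0 + l' 1 + l' 2) with h | h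
  · refine ⟨2, .inl rfl, h.mono ?_ ?_⟩ <;> simp [startCoord, totalLen] at * <;> linarith
  · refine ⟨3, .inr rfl, h.mono ?_ ?_⟩ <;> simp [startCoord, totalLen] at * <;> linarith

theorem exists_memPiece_one (hk : IsKeaneStep m n l l') (hl' : ∀ i, 0 < l' i) {u : ℝ}
    (hu : MemPiece b l 1 u) :
    ∃ i s, (i = 0 ∧ s < m ∨ i = 1 ∧ s < m + 1) ∧
      MemPiece (!b) l' i (l 3 + s * shiftCoord l 1 - u) := by
  obtain ⟨e0, e1, e2, e3⟩ := hk
  have h0 := hl' 0; have h1 := hl' 1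
  have hw : shiftCoord l 1 = l' 0 + l' 1 := by
    simp [shiftCoord, totalLen] at *; linarith
  obtain ⟨s, hs, h⟩ := MemSided.exists_block (p := l 0) (w := l' 0 + l' 1) (u := u) (m + 1)
    (MemSided.mono hu (by simp [startCoord]) (by
      simp only [startCoord, Matrix.cons_val_one, Matrix.cons_val_zero, e1]
      push_cast; linarith))
  rcases h.split (l 0 + s * (l' 0 + l' 1) + l' 1) with h | h
  · refine ⟨1, s, .inr ⟨rfl, hs⟩, (h.reflect (l 3 + s * shiftCoord l 1)).mono ?_ ?_⟩ <;>
      rw [hw] <;> simp [startCoord, totalLen] at * <;> linarith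
  · have hsm : s < m := by
      by_contra hc
      obtain rfl : s = m := by omega
      have h2 := h.disjoint hu
      simp only [startCoord, Matrix.cons_val_one, Matrix.cons_val_zero, e1] at h2
      linarith
    refine ⟨0, s, .inl ⟨rfl, hsm⟩, (h.reflect (l 3 + s * shiftCoord l 1)).mono ?_ ?_⟩ <;>
      rw [hw] <;> simp [startCoord, totalLen] at * <;> linarith

theorem exists_memPiece_two (hk : IsKeaneStep m n l l') (hl' : ∀ i, 0 < l' i) {u : ℝ}
    (hu : MemPiece b l 2 u) :
    ∃ i j, j < thirdVisits n i ∧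
      MemPiece (!b) l' i (totalLen l + prefixShift m l i + j * shiftCoord l 2 - u) := by
  obtain ⟨e0, e1, e2, e3⟩ := hk
  have h0 := hl' 0; have h1 := hl' 1; have h2 := hl' 2; have h3 := hl' 3
  have hw : shiftCoord l 2 = totalLen l' := e3
  obtain ⟨j, hj, h⟩ := MemSided.exists_block (p := l 0 + l 1) (w := totalLen l') (u := u) (n + 1)
    (MemSided.mono hu (by simp [startCoord]) (by
      simp [startCoord, e2, totalLen]; linarith))
  have key : ∀ i p q, j < thirdVisits n i → MemSided b p q u →
      startCoord l' i ≤ totalLen l + prefixShift m l i + j * shiftCoord l 2 - q →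
      totalLen l + prefixShift m l i + j * shiftCoord l 2 - p ≤ startCoord l' i + l' i →
      ∃ i j, j < thirdVisits n i ∧
      MemPiece (!b) l' i (totalLen l + prefixShift m l i + j * shiftCoord l 2 - u) :=
    fun i p q hj hm hp hq => ⟨i, j, hj,
      (hm.reflect (totalLen l + prefixShift m l i + j * shiftCoord l 2)).mono hp hq⟩
  have hpre : ∀ i, totalLen l + prefixShift m l i = l 0 + l 1 +
      ![l' 0, l' 0 + (l' 0 + l' 1), totalLen l' + (l' 0 + l' 1), totalLen l' + (l' 0 + l' 1)] i := by
    intro i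
    fin_cases i <;> simp [totalLen, prefixShift, shiftCoord, e0, e1, e2, e3] <;> ring
  simp only [hpre, hw] at key ⊢
  rcases h.split (l 0 + l 1 + j * totalLen l' + l' 0) with h | h
  · refine key 0 _ _ hj h ?_ ?_ <;> simp [startCoord] <;> linarith
  rcases h.split (l 0 + l 1 + j * totalLen l' + (l' 0 + l' 1)) with h | h
  · refine key 1 _ _ hj h ?_ ?_ <;> simp [startCoord] <;> linarith
  rcases h.split (l 0 + l 1 + j * totalLen l' + (l' 0 + l' 1) + l' 3) with h | h
  · refine key 3 _ _ hj h ?_ ?_ <;> simp [startCoord, totalLen] <;> linarith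
  · have hjn : j < n := by
      by_contra hc
      obtain rfl : j = n := by omega
      have h2 := h.disjoint hu
      simp [startCoord, e2] at h2
      linarith
    refine key 2 _ _ hjn h ?_ ?_ <;> simp [startCoord, totalLen] <;> linarith

theorem exists_predecessor (R : IsRenormalization T a b l h) (hk : IsKeaneStep m n l l')
    (hl' : ∀ i, 0 < l' i) {i : Fin 4} {u : ℝ} (hu : MemPiece b l i u) :
    ∃ i' u' r, MemPiece (!b) l' i' u' ∧ r + h i ≤ nextTime m n h i' ∧
      T^[r] (chart a b (totalLen l - u')) = chart a b u := by
  have e3 := hk.2.2.2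
  have hsh : totalLen l + shiftCoord l 3 = l 3 := by
    simp [totalLen, shiftCoord]; ring
  match i, hu with
  | 0, hu =>
    obtain ⟨i, hi, hu'⟩ := exists_memPiece_zero hk hu
    refine ⟨i, _, h 3, hu', ?_, ?_⟩
    · rcases hi with rfl | rfl <;> simp [nextTime, prefixTime]
    · have hm := memPiece_three_reflect hk (hu'.mem_total hl')
      rw [(R.move 3 _ _ hm hm).2.1]
      congr 1; linarith
  | 1, hu =>
    obtain ⟨i, s, hi, hu'⟩ := exists_memPiece_one hk hl' hu
    refine ⟨i, _, h 3 + s * h 1, hu', ?_, ?_⟩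
    · rcases hi with ⟨rfl, hs⟩ | ⟨rfl, hs⟩ <;>
        simp only [nextTime, prefixTime, Matrix.cons_val_one, Matrix.cons_val_zero]
      · have : (s + 1) * h 1 ≤ m * h 1 := Nat.mul_le_mul_right _ hs
        linarith [Nat.zero_le (thirdVisits n 0 * h 2)]
      · have : (s + 1) * h 1 ≤ (m + 1) * h 1 := Nat.mul_le_mul_right _ hs
        linarith [Nat.zero_le (thirdVisits n 1 * h 2)]
    · rw [(second_move R hk hl' (by omega) hu' hu').2.1]
      congr 1; linarith
  | 2, hu =>
    obtain ⟨i, j, hj, hu'⟩ := exists_memPiece_two hk hl' hu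
    refine ⟨i, _, prefixTime m h i + j * h 2, hu', ?_, ?_⟩
    · have : (j + 1) * h 2 ≤ thirdVisits n i * h 2 := Nat.mul_le_mul_right _ hj
      simp only [nextTime]; linarith
    · rw [(third_move R hk hl' hj.le hu' hu').2.1]
      congr 1; linarith
  | 3, hu =>
    have hu' : MemSided (!b) 0 (totalLen l') (totalLen l - u) :=
      (hu.reflect (totalLen l)).mono (by simp [startCoord, totalLen])
        (by simp only [startCoord, ← e3]; simp [totalLen])
    obtain ⟨i, hi⟩ := exists_memPiece hu'
    refine ⟨i, _, 0, hi, ?_, by simp⟩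
    have : h 3 ≤ prefixTime m h i := by fin_cases i <;> simp [prefixTime]
    simp only [nextTime, zero_add]
    exact this.trans (Nat.le_add_right _ _)

theorem IsRenormalization.next (R : IsRenormalization T a b l h) (hk : IsKeaneStep m n l l')
    (hl' : ∀ i, 0 < l' i) :
    IsRenormalization T (a + sideSign b * totalLen l) (!b) l' (nextTime m n h) where
  move i u v hu hv := by
    refine ParallelMove.reflect ?_
    rw [← prefixShift_add hk i]
    exact third_move R hk hl' le_rfl hu hv
  cover x hx := by
    obtain ⟨i, u, s, hu, hs, rfl⟩ := R.cover x hx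
    obtain ⟨i', u', r, hu', hr, he⟩ := exists_predecessor R hk hl' hu
    refine ⟨i', u', s + r, hu', by omega, ?_⟩
    rw [chart_reflect, Function.iterate_add_apply, he]
  inside u hu := by
    rw [chart_reflect]
    have h3 := memPiece_three_reflect hk hu
    refine R.inside _ (h3.mono ?_ ?_)
    · obtain ⟨e0, e1, e2, e3⟩ := hk
      have h0 := hl' 0; have h1 := hl' 1; have h2 := hl' 2; have h3 := hl' 3
      have : 0 < totalLen l' := by simp [totalLen]; linarith
      simp [startCoord, e0, e1, e2]
      positivity
    · simp [startCoord, totalLen]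

end Step

theorem exists_ge_mul_modEq {a b : ℕ} (hab : a.Coprime b) (hb : 0 < b) (c N : ℕ) :
    ∃ x, N ≤ x ∧ x * a ≡ c [MOD b] := by
  have : NeZero b := ⟨hb.ne'⟩
  refine ⟨((a : ZMod b)⁻¹ * c).val + N * b, ?_, ?_⟩
  · exact (Nat.le_mul_of_pos_right N hb).trans (Nat.le_add_left _ _)
  · rw [← ZMod.natCast_eq_natCast_iff]
    push_cast
    rw [ZMod.natCast_zmod_val, ZMod.natCast_self, mul_zero, add_zero, mul_right_comm,
      mul_comm _ (a : ZMod b), ZMod.coe_mul_inv_eq_one a hab, one_mul]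

/-- Conditions on the `k`-th heights `h` and parameters `m`, `n` of the construction. -/
structure IsGoodStep (k : ℕ) (h : Fin 4 → ℕ) (m n : ℕ) : Prop where
  pos : ∀ i, 0 < h i
  coprime : (h 1).Coprime (h 2)
  second_large : 2 * (h 1 * h 2) + h 0 + h 2 + h 3 + 2 ≤ m
  third_large : (k + 1) * (h 3 + h 0 + (m + 1) * h 1 + h 2 + 1) + 2 * h 1 + 2 ≤ n

theorem nextTime_pos {h : Fin 4 → ℕ} (hpos : ∀ i, 0 < h i) (m n : ℕ) (i : Fin 4) :
    0 < nextTime m n h i := by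
  have := hpos 3
  fin_cases i <;> simp [nextTime, prefixTime] <;> omega

theorem exists_isGoodStep (k : ℕ) {h : Fin 4 → ℕ} (hpos : ∀ i, 0 < h i)
    (hcop : (h 1).Coprime (h 2)) :
    ∃ m n, IsGoodStep k h m n ∧ (nextTime m n h 1).Coprime (nextTime m n h 2) := by
  obtain ⟨x, hx, hmod⟩ := exists_ge_mul_modEq hcop (hpos 2) (h 0 + 1)
    (2 * (h 1 * h 2) + h 0 + h 2 + h 3 + 3)
  obtain ⟨m, rfl⟩ : ∃ m, x = m + 1 := ⟨x - 1, by omega⟩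
  have hm : m + 1 ≤ (m + 1) * h 1 := Nat.le_mul_of_pos_right _ (hpos 1)
  obtain ⟨D, hD⟩ : ∃ D, D + 1 + h 0 = (m + 1) * h 1 + h 2 :=
    ⟨(m + 1) * h 1 + h 2 - h 0 - 1, by omega⟩
  have hDc : (h 2).Coprime (D + 1) := by
    have h1 : D + 1 + h 0 ≡ 1 + h 0 [MOD h 2] := by
      rw [hD, add_comm 1]
      simpa [Nat.ModEq] using hmod
    exact (Nat.coprime_comm.mp ((h1.add_right_cancel' _).gcd_eq.trans (Nat.gcd_one_left _)))
  obtain ⟨n, hn, hnmod⟩ := exists_ge_mul_modEq hDc (Nat.succ_pos D) (1 + D * (h 3 + h 0))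
    ((k + 1) * (h 3 + h 0 + (m + 1) * h 1 + h 2 + 1) + 2 * h 1 + 2)
  refine ⟨m, n, ⟨hpos, hcop, by omega, hn⟩, ?_⟩
  have e2 : nextTime m n h 2 = h 3 + h 0 + n * h 2 := rfl
  have e1 : nextTime m n h 1 = D + 1 + nextTime m n h 2 := by
    have : nextTime m n h 1 = h 3 + (m + 1) * h 1 + (n + 1) * h 2 := rfl
    rw [this, e2]; linarith
  have hc : (nextTime m n h 2).Coprime (D + 1) := by
    have h1 : nextTime m n h 2 ≡ 1 [MOD D + 1] := by
      rw [e2]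
      have h2 := hnmod.add_left (h 3 + h 0)
      refine h2.trans ?_
      have : h 3 + h 0 + (1 + D * (h 3 + h 0)) = 1 + (D + 1) * (h 3 + h 0) := by ring
      rw [this]
      simp [Nat.ModEq]
    exact h1.gcd_eq.trans (Nat.gcd_one_left _)
  rw [e1]
  simpa [Nat.coprime_comm] using hc

theorem exists_parameters : ∃ (m n : ℕ → ℕ) (h : ℕ → Fin 4 → ℕ), h 0 = (fun _ => 1) ∧
    (∀ k, h (k + 1) = nextTime (m k) (n k) (h k)) ∧ ∀ k, IsGoodStep k (h k) (m k) (n k) := by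
  let S := {h : Fin 4 → ℕ // (∀ i, 0 < h i) ∧ (h 1).Coprime (h 2)}
  choose m n hgood hcop using fun (k : ℕ) (h : S) => exists_isGoodStep k h.2.1 h.2.2
  let H : ℕ → S := fun k => Nat.rec ⟨fun _ => 1, by simp, by simp⟩
    (fun k h => ⟨nextTime (m k h) (n k h) h, nextTime_pos h.2.1 _ _, hcop k h⟩) k
  exact ⟨fun k => m k (H k), fun k => n k (H k), fun k => (H k).1, rfl, fun k => rfl,
    fun k => hgood k (H k)⟩

theorem exists_finite_lengths (N : ℕ) : ∀ m n : ℕ → ℕ, ∃ l : ℕ → Fin 4 → ℝ,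
    (∀ k i, 0 ≤ l k i) ∧ 0 < totalLen (l 0) ∧ (∀ k, totalLen (l k) ≤ totalLen (l 0)) ∧
      ∀ k < N, IsKeaneStep (m k) (n k) (l k) (l (k + 1)) := by
  induction N with
  | zero =>
    intro m n
    exact ⟨fun _ _ => 1, by simp, by norm_num [totalLen], by simp, by simp⟩
  | succ N ih =>
    intro m n
    obtain ⟨l, h0, hpos, hle, hstep⟩ := ih (fun k => m (k + 1)) (fun k => n (k + 1))
    let x : Fin 4 → ℝ := ![l 0 2 + l 0 3, m 0 * l 0 0 + (m 0 + 1) * l 0 1,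
      n 0 * totalLen (l 0) + (l 0 0 + l 0 1 + l 0 3), totalLen (l 0)]
    have h00 := h0 0 0; have h01 := h0 0 1; have h02 := h0 0 2; have h03 := h0 0 3
    have hx : ∀ i, 0 ≤ x i := by
      intro i
      fin_cases i <;> simp [x] <;> positivity
    have hx3 : x 3 = totalLen (l 0) := rfl
    have hle0 : totalLen (l 0) ≤ totalLen x := by
      rw [← hx3, totalLen]; linarith [hx 0, hx 1, hx 2]
    refine ⟨fun k => Nat.casesOn k x l, ?_, by simpa using hpos.trans_le hle0, ?_, ?_⟩
    · rintro (_ | k)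
      · exact hx
      · exact h0 k
    · rintro (_ | k)
      · exact le_rfl
      · exact (hle k).trans hle0
    · rintro (_ | k) hk
      · exact ⟨rfl, rfl, rfl, rfl⟩
      · exact hstep k (by omega)

theorem isClosed_isKeaneStep (m n k : ℕ) :
    IsClosed {l : ℕ → Fin 4 → ℝ | IsKeaneStep m n (l k) (l (k + 1))} := by
  simp only [IsKeaneStep, totalLen, Set.ofPred_and]
  refine IsClosed.inter ?_ (IsClosed.inter ?_ (IsClosed.inter ?_ ?_)) <;>
    exact isClosed_eq (by fun_prop) (by fun_prop)

theorem IsKeaneStep.div {m n : ℕ} {l l' : Fin 4 → ℝ} (hk : IsKeaneStep m n l l') (c : ℝ) :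
    IsKeaneStep m n (fun i => l i / c) (fun i => l' i / c) := by
  obtain ⟨e0, e1, e2, e3⟩ := hk
  refine ⟨?_, ?_, ?_, ?_⟩ <;> simp only [totalLen, e0, e1, e2, e3] <;> ring

theorem exists_nonneg_lengths (m n : ℕ → ℕ) : ∃ l : ℕ → Fin 4 → ℝ,
    (∀ k i, 0 ≤ l k i) ∧ totalLen (l 0) = 1 ∧
      ∀ k, IsKeaneStep (m k) (n k) (l k) (l (k + 1)) := by
  let K : Set (ℕ → Fin 4 → ℝ) :=
    Set.univ.pi fun _ => Set.univ.pi fun _ => Set.Icc (0 : ℝ) 1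
  have hK : IsCompact K := isCompact_univ_pi fun _ => isCompact_univ_pi fun _ => isCompact_Icc
  let t : ℕ → Set (ℕ → Fin 4 → ℝ) := fun N =>
    K ∩ ({l | totalLen (l 0) = 1} ∩
      ⋂ k, ⋂ (_ : k < N), {l | IsKeaneStep (m k) (n k) (l k) (l (k + 1))})
  have hclosed : ∀ N, IsClosed ({l : ℕ → Fin 4 → ℝ | totalLen (l 0) = 1} ∩
      ⋂ k, ⋂ (_ : k < N), {l | IsKeaneStep (m k) (n k) (l k) (l (k + 1))}) := fun N =>
    (isClosed_eq (by simp only [totalLen]; fun_prop) (by fun_prop)).inter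
      (isClosed_iInter fun k => isClosed_iInter fun _ => isClosed_isKeaneStep _ _ _)
  have hne : (⋂ N, t N).Nonempty := by
    refine IsCompact.nonempty_iInter_of_sequence_nonempty_isCompact_isClosed t ?_ ?_
      (hK.inter_right (hclosed 0)) fun N => hK.isClosed.inter (hclosed N)
    · rintro N l ⟨hl, h1, h2⟩
      refine ⟨hl, h1, ?_⟩
      simp only [Set.mem_iInter] at h2 ⊢
      exact fun k hk => h2 k (by omega)
    · intro N
      obtain ⟨l, h0, hpos, hle, hstep⟩ := exists_finite_lengths N m n
      refine ⟨fun k i => l k i / totalLen (l 0), ?_, ?_, ?_⟩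
      · intro k _ i _
        refine ⟨div_nonneg (h0 k i) hpos.le, (div_le_one hpos).mpr ((hle k).trans' ?_)⟩
        have h00 := h0 k 0; have h01 := h0 k 1; have h02 := h0 k 2; have h03 := h0 k 3
        fin_cases i <;> simp [totalLen] <;> linarith
      · change totalLen (fun i => l 0 i / totalLen (l 0)) = 1
        have : totalLen (fun i => l 0 i / totalLen (l 0)) = totalLen (l 0) / totalLen (l 0) := by
          simp only [totalLen]; ring
        rw [this, div_self hpos.ne']
      · simp only [Set.mem_iInter]
        exact fun k hk => (hstep k hk).div _
  obtain ⟨l, hl⟩ := hne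
  simp only [Set.mem_iInter] at hl
  refine ⟨l, fun k i => ((hl 0).1 k trivial i trivial).1, (hl 0).2.1, fun k => ?_⟩
  have := (hl (k + 1)).2.2
  simp only [Set.mem_iInter] at this
  exact this k (by omega)

theorem exists_lengths {m n : ℕ → ℕ} (hm : ∀ k, 0 < m k) (hn : ∀ k, 0 < n k) :
    ∃ l : ℕ → Fin 4 → ℝ, (∀ k i, 0 < l k i) ∧ totalLen (l 0) = 1 ∧
      ∀ k, IsKeaneStep (m k) (n k) (l k) (l (k + 1)) := by
  obtain ⟨l, h0, h1, hk⟩ := exists_nonneg_lengths m n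
  have htot : ∀ k, 0 < totalLen (l k) := by
    intro k
    induction k with
    | zero => rw [h1]; exact one_pos
    | succ k ih =>
      by_contra hc
      obtain ⟨e0, e1, e2, e3⟩ := hk k
      have a0 := h0 (k + 1) 0; have a1 := h0 (k + 1) 1
      have a2 := h0 (k + 1) 2; have a3 := h0 (k + 1) 3
      have hc' : totalLen (l (k + 1)) = 0 := by
        refine le_antisymm (not_lt.mp hc) ?_
        simp only [totalLen]; positivity
      simp only [totalLen] at hc'
      have z0 : l (k + 1) 0 = 0 := by linarith
      have z1 : l (k + 1) 1 = 0 := by linarith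
      have z2 : l (k + 1) 2 = 0 := by linarith
      have z3 : l (k + 1) 3 = 0 := by linarith
      simp [totalLen, e0, e1, e2, e3, z0, z1, z2, z3] at ih
  have p2 : ∀ k, 0 < l k 2 := fun k => by
    rw [(hk k).2.2.1]
    have := htot (k + 1)
    have hn' : (0 : ℝ) < n k := by exact_mod_cast hn k
    have := mul_pos hn' this
    linarith [h0 (k + 1) 0, h0 (k + 1) 1, h0 (k + 1) 3]
  have p0 : ∀ k, 0 < l k 0 := fun k => by
    rw [(hk k).1]; linarith [p2 (k + 1), h0 (k + 1) 3]
  have p1 : ∀ k, 0 < l k 1 := fun k => by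
    rw [(hk k).2.1]
    have hm' : (0 : ℝ) < m k := by exact_mod_cast hm k
    have := mul_pos hm' (p0 (k + 1))
    have := mul_nonneg (add_nonneg hm'.le zero_le_one) (h0 (k + 1) 1)
    linarith
  have p3 : ∀ k, 0 < l k 3 := fun k => by rw [(hk k).2.2.2]; exact htot _
  refine ⟨l, fun k i => ?_, h1, hk⟩
  fin_cases i
  · exact p0 k
  · exact p1 k
  · exact p2 k
  · exact p3 k

theorem IsKeaneStep.totalLen_le {m n : ℕ} {l l' : Fin 4 → ℝ} (hk : IsKeaneStep m n l l')
    (hn : 0 < n) (hl : ∀ i, 0 < l i) (hl' : ∀ i, 0 < l' i) :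
    totalLen l' ≤ totalLen l / 2 := by
  obtain ⟨e0, e1, e2, e3⟩ := hk
  have hn' : (1 : ℝ) ≤ n := by exact_mod_cast hn
  have hpos : 0 < totalLen l' := e3 ▸ hl 3
  have h2 : totalLen l' ≤ n * totalLen l' := le_mul_of_one_le_left hpos.le hn'
  have e : totalLen l = l 0 + l 1 + l 2 + l 3 := rfl
  linarith [hl 0, hl 1, hl' 0, hl' 1, hl' 3]

theorem totalLen_le_pow {m n : ℕ → ℕ} {l : ℕ → Fin 4 → ℝ} (hn : ∀ k, 0 < n k)
    (hl : ∀ k i, 0 < l k i) (h1 : totalLen (l 0) = 1)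
    (hk : ∀ k, IsKeaneStep (m k) (n k) (l k) (l (k + 1))) (k : ℕ) :
    totalLen (l k) ≤ (1 / 2) ^ k := by
  induction k with
  | zero => simp [h1]
  | succ k ih =>
    have := (hk k).totalLen_le (hn k) (hl k) (hl (k + 1))
    rw [pow_succ]; linarith

section BaseMap

variable {L : Fin 4 → ℝ}

/-- The interval exchange sending the order `1 2 3 4` to the order `4 2 1 3`. -/
noncomputable abbrev keaneMap (L : Fin 4 → ℝ) : ℝ → ℝ := ietMap perm4213.symm L

theorem leftEnd_eq_startCoord (L : Fin 4 → ℝ) (i : Fin 4) : leftEnd L i = startCoord L i := by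
  fin_cases i <;> simp [leftEnd, startCoord, Finset.sum_filter, Fin.sum_univ_four]

theorem memPiece_true_iff {i : Fin 4} {x : ℝ} :
    MemPiece true L i x ↔ x ∈ Set.Ico (startCoord L i) (startCoord L i + L i) := by
  simp [MemPiece, MemSided]

theorem sub_leftEnd_add_sum (L : Fin 4 → ℝ) (i : Fin 4) (x : ℝ) :
    x - leftEnd L i + ∑ k ∈ univ.filter (fun k => perm4213.symm k < perm4213.symm i), L k =
      x + shiftCoord L i := by
  rw [leftEnd_eq_startCoord, Finset.sum_filter, Fin.sum_univ_four]
  fin_cases i <;> simp [startCoord, shiftCoord, perm4213, Fin.lt_def] <;> ring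

theorem MemPiece.unique {b : Bool} (hL : ∀ i, 0 < L i) {i j : Fin 4} {x : ℝ}
    (hi : MemPiece b L i x) (hj : MemPiece b L j x) : i = j := by
  have h0 := hL 0; have h1 := hL 1; have h2 := hL 2; have h3 := hL 3
  have h := MemSided.disjoint hi hj
  have h' := MemSided.disjoint hj hi
  fin_cases i <;> fin_cases j <;> simp [startCoord] at h h' ⊢ <;> linarith

theorem keaneMap_of_memPiece (hL : ∀ i, 0 < L i) {i : Fin 4} {x : ℝ}
    (hx : MemPiece true L i x) : keaneMap L x = x + shiftCoord L i := by
  have h : ∃ j : Fin 4, x ∈ Set.Ico (leftEnd L j) (leftEnd L j + L j) :=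
    ⟨i, by simpa [leftEnd_eq_startCoord] using memPiece_true_iff.mp hx⟩
  have hi : h.choose = i := by
    refine MemPiece.unique (b := true) hL (memPiece_true_iff.mpr ?_) hx
    simpa only [leftEnd_eq_startCoord] using h.choose_spec
  rw [keaneMap, ietMap, dif_pos h, sub_leftEnd_add_sum, hi]

theorem exists_memPiece_true (h1 : totalLen L = 1) {x : ℝ} (hx : x ∈ Set.Ico (0 : ℝ) 1) :
    ∃ i, MemPiece true L i x :=
  exists_memPiece (by simpa [MemSided, h1] using hx)

theorem MemPiece.mem_Ico (hL : ∀ i, 0 < L i) (h1 : totalLen L = 1) {i : Fin 4} {x : ℝ}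
    (hx : MemPiece true L i x) : x ∈ Set.Ico (0 : ℝ) 1 := by
  simpa [MemSided, h1] using hx.mem_total hL

theorem keaneMap_of_notMem (hL : ∀ i, 0 < L i) (h1 : totalLen L = 1) {x : ℝ}
    (hx : x ∉ Set.Ico (0 : ℝ) 1) : keaneMap L x = x := by
  refine dif_neg ?_
  rintro ⟨i, hi⟩
  rw [leftEnd_eq_startCoord] at hi
  exact hx ((memPiece_true_iff.mpr hi).mem_Ico hL h1)

theorem isRenormalization_keaneMap (hL : ∀ i, 0 < L i) (h1 : totalLen L = 1) :
    IsRenormalization (keaneMap L) 0 true L (fun _ => 1) where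
  move i u v hu hv := by
    have hu' := keaneMap_of_memPiece hL hu
    have hv' := keaneMap_of_memPiece hL hv
    refine ⟨fun s hs => ?_, ?_, ?_⟩
    · interval_cases s
      · rfl
      · simp [chart, sideSign, hu', hv']
    · simp [chart, sideSign, hu']
    · simp [chart, sideSign, hv']
  cover x hx := by
    obtain ⟨i, hi⟩ := exists_memPiece_true h1 hx
    exact ⟨i, x, 0, hi, one_pos, by simp [chart, sideSign]⟩
  inside u hu := by
    rw [h1] at hu
    simpa [chart, sideSign, MemSided] using hu

theorem exists_shift_add_mem (h1 : totalLen L = 1) {x : ℝ} (hx : x ∈ Set.Ico (0 : ℝ) 1) :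
    ∃ i, MemPiece true L i (x - shiftCoord L i) := by
  simp only [memPiece_true_iff]
  simp only [totalLen] at h1
  obtain ⟨h0, hx1⟩ := hx
  rcases lt_or_ge x (L 3) with h | h
  · refine ⟨3, ?_, ?_⟩ <;> simp [startCoord, shiftCoord] <;> linarith
  rcases lt_or_ge x (L 3 + L 1) with h' | h'
  · refine ⟨1, ?_, ?_⟩ <;> simp [startCoord, shiftCoord] <;> linarith
  rcases lt_or_ge x (L 3 + L 1 + L 0) with h'' | h''
  · refine ⟨0, ?_, ?_⟩ <;> simp [startCoord, shiftCoord] <;> linarith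
  · refine ⟨2, ?_, ?_⟩ <;> simp [startCoord, shiftCoord] <;> linarith

theorem memPiece_shift_mem_Ico (hL : ∀ i, 0 < L i) (h1 : totalLen L = 1) {i : Fin 4} {x : ℝ}
    (hx : MemPiece true L i x) : x + shiftCoord L i ∈ Set.Ico (0 : ℝ) 1 := by
  have h0 := hL 0; have h1' := hL 1; have h2 := hL 2; have h3 := hL 3
  simp only [totalLen] at h1
  rw [memPiece_true_iff] at hx
  obtain ⟨h, h'⟩ := hx
  fin_cases i <;> simp [startCoord, shiftCoord] at h h' ⊢ <;> constructor <;> linarith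

theorem memPiece_shift_unique (hL : ∀ i, 0 < L i) {i j : Fin 4} {x : ℝ}
    (hi : MemPiece true L i (x - shiftCoord L i)) (hj : MemPiece true L j (x - shiftCoord L j)) :
    i = j := by
  have h0 := hL 0; have h1 := hL 1; have h2 := hL 2; have h3 := hL 3
  obtain ⟨a, a'⟩ := memPiece_true_iff.mp hi
  obtain ⟨c, c'⟩ := memPiece_true_iff.mp hj
  fin_cases i <;> fin_cases j <;> simp [startCoord, shiftCoord] at a a' c c' ⊢ <;> linarith

theorem mapsTo_keaneMap (hL : ∀ i, 0 < L i) (h1 : totalLen L = 1) :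
    Set.MapsTo (keaneMap L) (Set.Ico 0 1) (Set.Ico 0 1) := by
  intro x hx
  obtain ⟨i, hi⟩ := exists_memPiece_true h1 hx
  rw [keaneMap_of_memPiece hL hi]
  exact memPiece_shift_mem_Ico hL h1 hi

theorem injOn_keaneMap (hL : ∀ i, 0 < L i) (h1 : totalLen L = 1) :
    Set.InjOn (keaneMap L) (Set.Ico 0 1) := by
  intro x hx y hy hxy
  obtain ⟨i, hi⟩ := exists_memPiece_true h1 hx
  obtain ⟨j, hj⟩ := exists_memPiece_true h1 hy
  rw [keaneMap_of_memPiece hL hi, keaneMap_of_memPiece hL hj] at hxy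
  obtain rfl : i = j := by
    refine memPiece_shift_unique (x := x + shiftCoord L i) hL (by simpa using hi) ?_
    rw [hxy]; simpa using hj
  exact add_right_cancel hxy

theorem keaneMap_preimage_inter (hL : ∀ i, 0 < L i) (h1 : totalLen L = 1) (s : Set ℝ) :
    keaneMap L ⁻¹' s ∩ Set.Ico 0 1 =
      ⋃ i, {x | MemPiece true L i x} ∩ (fun x => x + shiftCoord L i) ⁻¹' s := by
  ext x
  simp only [Set.mem_inter_iff, Set.mem_preimage, Set.mem_iUnion, Set.mem_ofPred_eq]
  constructor
  · rintro ⟨hs, hx⟩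
    obtain ⟨i, hi⟩ := exists_memPiece_true h1 hx
    exact ⟨i, hi, by rwa [keaneMap_of_memPiece hL hi] at hs⟩
  · rintro ⟨i, hi, hs⟩
    exact ⟨by rwa [keaneMap_of_memPiece hL hi], hi.mem_Ico hL h1⟩

theorem measurableSet_memPiece (i : Fin 4) : MeasurableSet {x | MemPiece true L i x} := by
  simp only [memPiece_true_iff]
  exact measurableSet_Ico

theorem measurable_keaneMap (hL : ∀ i, 0 < L i) (h1 : totalLen L = 1) :
    Measurable (keaneMap L) := by
  intro s hs
  have : keaneMap L ⁻¹' s =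
      (keaneMap L ⁻¹' s ∩ Set.Ico 0 1) ∪ (s ∩ (Set.Ico 0 1)ᶜ) := by
    ext x
    by_cases hx : x ∈ Set.Ico (0 : ℝ) 1
    · simp [hx]
    · simp [hx, keaneMap_of_notMem hL h1 hx]
  rw [this, keaneMap_preimage_inter hL h1]
  exact (MeasurableSet.iUnion fun i =>
    (measurableSet_memPiece i).inter ((measurable_id.add_const _) hs)).union
      (hs.inter measurableSet_Ico.compl)

theorem volume_restrict_keaneMap_preimage (hL : ∀ i, 0 < L i) (h1 : totalLen L = 1)
    {s : Set ℝ} (hs : MeasurableSet s) :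
    volume.restrict (Set.Ico (0 : ℝ) 1) (keaneMap L ⁻¹' s) =
      volume.restrict (Set.Ico (0 : ℝ) 1) s := by
  have hm : ∀ i, MeasurableSet ({x | MemPiece true L i (x - shiftCoord L i)} ∩ s) := fun i =>
    ((measurableSet_memPiece i).preimage (measurable_id.sub_const _)).inter hs
  have hsplit : s ∩ Set.Ico 0 1 = ⋃ i, {x | MemPiece true L i (x - shiftCoord L i)} ∩ s := by
    ext x
    simp only [Set.mem_inter_iff, Set.mem_iUnion, Set.mem_ofPred_eq]
    constructor
    · rintro ⟨hx, hx'⟩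
      obtain ⟨i, hi⟩ := exists_shift_add_mem h1 hx'
      exact ⟨i, hi, hx⟩
    · rintro ⟨i, hi, hx⟩
      exact ⟨hx, by simpa using memPiece_shift_mem_Ico hL h1 hi⟩
  rw [Measure.restrict_apply' measurableSet_Ico, Measure.restrict_apply' measurableSet_Ico,
    keaneMap_preimage_inter hL h1, hsplit, measure_iUnion _ hm, measure_iUnion]
  · refine tsum_congr fun i => ?_
    rw [← measure_preimage_add_right volume (shiftCoord L i) (_ ∩ s)]
    congr 1
    ext x
    simp
  · exact fun i j hij => Set.disjoint_left.mpr fun x hx hx' =>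
      hij (MemPiece.unique (b := true) (x := x) hL hx.1 hx'.1)
  · exact fun i => (measurableSet_memPiece i).inter ((measurable_id.add_const _) hs)
  · exact fun i j hij => Set.disjoint_left.mpr fun x hx hx' =>
      hij (memPiece_shift_unique (x := x) hL hx.1 hx'.1)

end BaseMap

/-- The points whose oriented coordinate lies in the `i`-th interval. -/
def base (a : ℝ) (b : Bool) (l : Fin 4 → ℝ) (i : Fin 4) : Set ℝ :=
  {x | ∃ u, MemPiece b l i u ∧ x = chart a b u}

section StepPoints

variable {T : ℝ → ℝ} {a : ℝ} {b : Bool} {l l' : Fin 4 → ℝ} {h : Fin 4 → ℕ} {m n : ℕ}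

theorem base_nonempty (hl : ∀ i, 0 < l i) (i : Fin 4) : (base a b l i).Nonempty := by
  refine ⟨_, startCoord l i + l i / 2, ?_, rfl⟩
  have := hl i
  cases b <;> simp only [MemPiece, MemSided, if_true, Bool.false_eq_true, if_false] <;>
    constructor <;> linarith

theorem mem_base_three_of_mem_base (hk : IsKeaneStep m n l l') (hl' : ∀ i, 0 < l' i) {i : Fin 4}
    {x : ℝ} (hx : x ∈ base (a + sideSign b * totalLen l) (!b) l' i) : x ∈ base a b l 3 := by
  obtain ⟨u, hu, rfl⟩ := hx
  exact ⟨_, memPiece_three_reflect hk (hu.mem_total hl'), chart_reflect _ _ _ _⟩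

theorem iterate_mem_base_zero (R : IsRenormalization T a b l h) (hk : IsKeaneStep m n l l')
    (hl' : ∀ i, 0 < l' i) {i : Fin 4} (hi : i = 2 ∨ i = 3) {x : ℝ}
    (hx : x ∈ base (a + sideSign b * totalLen l) (!b) l' i) : T^[h 3] x ∈ base a b l 0 := by
  obtain ⟨u, hu, rfl⟩ := hx
  have hm := memPiece_three_reflect hk (hu.mem_total hl')
  refine ⟨_, memPiece_zero_of hk hl' hi hu, ?_⟩
  rw [chart_reflect, (R.move 3 _ _ hm hm).2.1]

theorem iterate_mem_base_one (R : IsRenormalization T a b l h) (hk : IsKeaneStep m n l l')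
    (hl' : ∀ i, 0 < l' i) {i : Fin 4} {s : ℕ} (hi : i = 0 ∧ s < m ∨ i = 1 ∧ s < m + 1) {x : ℝ}
    (hx : x ∈ base (a + sideSign b * totalLen l) (!b) l' i) :
    T^[h 3 + s * h 1] x ∈ base a b l 1 := by
  obtain ⟨u, hu, rfl⟩ := hx
  refine ⟨_, memPiece_one_of hk hl' hi hu, ?_⟩
  rw [chart_reflect, (second_move R hk hl' (by omega) hu hu).2.1, add_assoc]

theorem iterate_mem_base_two (R : IsRenormalization T a b l h) (hk : IsKeaneStep m n l l')
    (hl' : ∀ i, 0 < l' i) {i : Fin 4} {j : ℕ} (hj : j < thirdVisits n i) {x : ℝ}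
    (hx : x ∈ base (a + sideSign b * totalLen l) (!b) l' i) :
    T^[prefixTime m h i + j * h 2] x ∈ base a b l 2 := by
  obtain ⟨u, hu, rfl⟩ := hx
  refine ⟨_, memPiece_two_of hk hl' hj hu, ?_⟩
  rw [chart_reflect, (third_move R hk hl' hj.le hu hu).2.1, add_assoc]

end StepPoints

theorem exists_combination {m n p q N : ℕ} (hpq : p.Coprime q) (hp : 0 < p) (hq : 0 < q)
    (hm : q ≤ m) (hn : (m + 1) * p + q ≤ n * q) (hN : p * q + q ≤ N)
    (hN' : N + q * p ≤ n * q + (m + 2) * p) :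
    ∃ i j, 1 ≤ i ∧ i ≤ m + 1 ∧ 1 ≤ j ∧ j ≤ n ∧ N = i * p + j * q := by
  have window : ∀ c, ∃ i, c ≤ i ∧ i < c + q ∧ i * p ≡ N [MOD q] := by
    intro c
    obtain ⟨x, hx, hmod⟩ := exists_ge_mul_modEq hpq hq N c
    refine ⟨c + (x - c) % q, by omega, Nat.add_lt_add_left (Nat.mod_lt _ hq) _, ?_⟩
    refine Nat.ModEq.trans (Nat.ModEq.mul_right p ?_) hmod
    have := (Nat.mod_modEq (x - c) q).add_left c
    rwa [Nat.add_sub_cancel' hx] at this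
  have finish : ∀ i, 1 ≤ i → i ≤ m + 1 → i * p ≡ N [MOD q] → i * p + q ≤ N →
      N ≤ i * p + n * q → ∃ i j, 1 ≤ i ∧ i ≤ m + 1 ∧ 1 ≤ j ∧ j ≤ n ∧ N = i * p + j * q := by
    intro i hi hi' hmod h1 h2
    obtain ⟨j, hj⟩ := (Nat.modEq_iff_dvd' (by omega)).mp hmod
    have hj' : N = i * p + j * q := by rw [mul_comm j]; omega
    refine ⟨i, j, hi, hi', ?_, ?_, hj'⟩
    · by_contra hc
      obtain rfl : j = 0 := by omega
      simp at hj; omega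
    · exact Nat.le_of_mul_le_mul_right (by omega) hq
  rcases le_or_gt N (n * q + p) with hle | hgt
  · obtain ⟨i, hi, hi', hmod⟩ := window 1
    have h1 : i * p ≤ q * p := Nat.mul_le_mul_right _ (by omega)
    have h2 : 1 * p ≤ i * p := Nat.mul_le_mul_right _ hi
    refine finish i hi (by omega) hmod ?_ ?_
    · rw [mul_comm q p] at h1; omega
    · omega
  · obtain ⟨c, hc⟩ := Nat.exists_eq_add_of_le (show q ≤ m + 2 by omega)
    obtain ⟨i, hi, hi', hmod⟩ := window c
    have h1 : i * p ≤ (m + 1) * p := Nat.mul_le_mul_right _ (by omega)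
    have h2 : c * p ≤ i * p := Nat.mul_le_mul_right _ hi
    have h3 : (m + 2) * p = q * p + c * p := by rw [hc, add_mul]
    exact finish i (by omega) (by omega) hmod (by omega) (by omega)

/-- A map together with an infinite sequence of nested renormalizations. -/
structure IsKeaneTower (T : ℝ → ℝ) (m n : ℕ → ℕ) (h : ℕ → Fin 4 → ℕ) (l : ℕ → Fin 4 → ℝ)
    (a : ℕ → ℝ) (b : ℕ → Bool) : Prop where
  len_pos : ∀ k i, 0 < l k i
  step : ∀ k, IsKeaneStep (m k) (n k) (l k) (l (k + 1))
  time_succ : ∀ k, h (k + 1) = nextTime (m k) (n k) (h k)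
  good : ∀ k, IsGoodStep k (h k) (m k) (n k)
  renorm : ∀ k, IsRenormalization T (a k) (b k) (l k) (h k)
  origin_succ : ∀ k, a (k + 1) = a k + sideSign (b k) * totalLen (l k)
  side_succ : ∀ k, b (k + 1) = !b k
  len_le : ∀ k, totalLen (l k) ≤ (1 / 2) ^ k
  mapsTo : Set.MapsTo T (Set.Ico 0 1) (Set.Ico 0 1)
  injOn : Set.InjOn T (Set.Ico 0 1)

namespace IsKeaneTower

variable {T : ℝ → ℝ} {m n : ℕ → ℕ} {h : ℕ → Fin 4 → ℕ} {l : ℕ → Fin 4 → ℝ}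
    {a : ℕ → ℝ} {b : ℕ → Bool}

theorem base_succ (K : IsKeaneTower T m n h l a b) (k : ℕ) (i : Fin 4) :
    base (a (k + 1)) (b (k + 1)) (l (k + 1)) i =
      base (a k + sideSign (b k) * totalLen (l k)) (!b k) (l (k + 1)) i := by
  rw [K.origin_succ, K.side_succ]

theorem mem_base_three (K : IsKeaneTower T m n h l a b) {k : ℕ} {i : Fin 4} {x : ℝ}
    (hx : x ∈ base (a (k + 1)) (b (k + 1)) (l (k + 1)) i) : x ∈ base (a k) (b k) (l k) 3 :=
  mem_base_three_of_mem_base (K.step k) (K.len_pos _) (K.base_succ k i ▸ hx)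

theorem iterate_mem_zero (K : IsKeaneTower T m n h l a b) {k : ℕ} {i : Fin 4}
    (hi : i = 2 ∨ i = 3) {x : ℝ} (hx : x ∈ base (a (k + 1)) (b (k + 1)) (l (k + 1)) i) :
    T^[h k 3] x ∈ base (a k) (b k) (l k) 0 :=
  iterate_mem_base_zero (K.renorm k) (K.step k) (K.len_pos _) hi (K.base_succ k i ▸ hx)

theorem iterate_mem_one (K : IsKeaneTower T m n h l a b) {k : ℕ} {i : Fin 4} {s : ℕ}
    (hi : i = 0 ∧ s < m k ∨ i = 1 ∧ s < m k + 1) {x : ℝ}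
    (hx : x ∈ base (a (k + 1)) (b (k + 1)) (l (k + 1)) i) :
    T^[h k 3 + s * h k 1] x ∈ base (a k) (b k) (l k) 1 :=
  iterate_mem_base_one (K.renorm k) (K.step k) (K.len_pos _) hi (K.base_succ k i ▸ hx)

theorem iterate_mem_two (K : IsKeaneTower T m n h l a b) {k : ℕ} {i : Fin 4} {j : ℕ}
    (hj : j < thirdVisits (n k) i) {x : ℝ}
    (hx : x ∈ base (a (k + 1)) (b (k + 1)) (l (k + 1)) i) :
    T^[prefixTime (m k) (h k) i + j * h k 2] x ∈ base (a k) (b k) (l k) 2 :=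
  iterate_mem_base_two (K.renorm k) (K.step k) (K.len_pos _) hj (K.base_succ k i ▸ hx)

theorem base_subset (K : IsKeaneTower T m n h l a b) (k : ℕ) (i : Fin 4) :
    base (a k) (b k) (l k) i ⊆ Set.Ico 0 1 := by
  rintro x ⟨u, hu, rfl⟩
  exact (K.renorm k).inside u (hu.mem_total (K.len_pos k))

theorem second_pos (K : IsKeaneTower T m n h l a b) (k : ℕ) : 0 < m k := by
  have := (K.good k).second_large; omega

theorem third_pos (K : IsKeaneTower T m n h l a b) (k : ℕ) : 0 < n k := by
  have := (K.good k).third_large; omega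

theorem time_one (K : IsKeaneTower T m n h l a b) (k : ℕ) :
    h (k + 1) 1 = h k 3 + (m k + 1) * h k 1 + (n k + 1) * h k 2 := by
  rw [K.time_succ]; rfl

theorem time_two (K : IsKeaneTower T m n h l a b) (k : ℕ) :
    h (k + 1) 2 = h k 3 + h k 0 + n k * h k 2 := by
  rw [K.time_succ]; rfl

theorem exists_hit_same (K : IsKeaneTower T m n h l a b) {k t i j : ℕ} (ht : t ≤ m (k + 1))
    (hi : 1 ≤ i) (hi' : i ≤ m k + 1) (hj : j ≤ n k) :
    ∃ x ∈ base (a k) (b k) (l k) 1,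
      T^[t * h (k + 1) 1 + (i * h k 1 + j * h k 2)] x ∈ base (a k) (b k) (l k) 2 := by
  obtain ⟨y, hy⟩ := base_nonempty (a := a (k + 2)) (b := b (k + 2)) (K.len_pos (k + 2)) 1
  have h1 := K.iterate_mem_one (s := 0) (.inr ⟨rfl, by omega⟩) hy
  have h2 := K.iterate_mem_one (s := t) (.inr ⟨rfl, by omega⟩) hy
  refine ⟨_, K.iterate_mem_one (s := m k + 1 - i) (.inr ⟨rfl, by omega⟩) h1, ?_⟩
  have h3 := K.iterate_mem_two (i := 1) (j := j) (Nat.lt_succ_of_le hj) h2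
  rw [← Function.iterate_add_apply] at h3 ⊢
  rw [← Function.iterate_add_apply]
  convert h3 using 2
  obtain ⟨c, hc⟩ := Nat.exists_eq_add_of_le hi'
  have : m k + 1 - i = c := by omega
  rw [this]
  simp only [prefixTime, Matrix.cons_val_one, Matrix.cons_val_zero, hc]
  ring

theorem exists_hit_diff (K : IsKeaneTower T m n h l a b) {k t i j : ℕ} (ht : t ≤ m (k + 1))
    (hi : 1 ≤ i) (hi' : i ≤ m k + 1) (hj : 1 ≤ j) (hj' : j ≤ n k) :
    ∃ x ∈ base (a k) (b k) (l k) 1,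
      T^[t * h (k + 1) 1 + h (k + 1) 2 + (i * h k 1 + j * h k 2)] x ∈
        base (a k) (b k) (l k) 2 := by
  obtain ⟨y, hy⟩ := base_nonempty (a := a (k + 2)) (b := b (k + 2)) (K.len_pos (k + 2)) 1
  have h1 := K.iterate_mem_one (s := m (k + 1) - t) (.inr ⟨rfl, by omega⟩) hy
  have h2 := K.iterate_mem_two (i := 1) (j := 0) (Nat.succ_pos _) hy
  refine ⟨_, K.iterate_mem_one (s := m k + 1 - i) (.inr ⟨rfl, by omega⟩) h1, ?_⟩
  have h3 := K.iterate_mem_two (i := 2) (j := j - 1) (show _ < n k by omega) h2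
  rw [← Function.iterate_add_apply] at h3 ⊢
  rw [← Function.iterate_add_apply]
  convert h3 using 2
  obtain ⟨c, hc⟩ := Nat.exists_eq_add_of_le hi'
  obtain ⟨d, hd⟩ := Nat.exists_eq_add_of_le ht
  obtain ⟨e, rfl⟩ := Nat.exists_eq_add_of_le hj
  have h4 : m k + 1 - i = c := by omega
  have h5 : m (k + 1) - t = d := by omega
  rw [h4, h5, Nat.add_sub_cancel_left]
  simp only [prefixTime, Matrix.cons_val_one, Matrix.cons_val_zero, Matrix.cons_val,
    hc, hd, K.time_one, K.time_two]
  ring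

theorem exists_hit_initial (K : IsKeaneTower T m n h l a b) {k N : ℕ}
    (hN : h k 1 * h k 2 + h k 2 ≤ N)
    (hN' : N < h k 1 * h k 2 + h k 2 + (m (k + 1) + 1) * h (k + 1) 1) :
    ∃ x ∈ base (a k) (b k) (l k) 1, T^[N] x ∈ base (a k) (b k) (l k) 2 := by
  obtain ⟨r, hr⟩ := Nat.exists_eq_add_of_le hN
  obtain ⟨hpos, hcop, hm, hn⟩ := K.good k
  have hpos' := (K.good (k + 1)).pos 1
  have ht : r / h (k + 1) 1 ≤ m (k + 1) :=
    Nat.lt_succ_iff.mp ((Nat.div_lt_iff_lt_mul hpos').mpr (by rw [Nat.succ_eq_add_one]; omega))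
  have hdiv := Nat.div_add_mod' r (h (k + 1) 1)
  have hmod := Nat.mod_lt r hpos'
  set t := r / h (k + 1) 1
  set s := r % h (k + 1) 1
  have e1 := K.time_one k
  have e2 := K.time_two k
  have p1 := hpos 1
  have p2 := hpos 2
  have g1 : m k ≤ m k * h k 1 := Nat.le_mul_of_pos_right _ p1
  have g2 : (h k 3 + h k 0 + (m k + 1) * h k 1 + h k 2 + 1) + 2 * h k 1 + 2 ≤ n k := by
    refine le_trans ?_ hn
    have : 1 * (h k 3 + h k 0 + (m k + 1) * h k 1 + h k 2 + 1) ≤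
      (k + 1) * (h k 3 + h k 0 + (m k + 1) * h k 1 + h k 2 + 1) :=
      Nat.mul_le_mul_right _ (by omega)
    omega
  have g3 : (2 * h k 1 + 2) * h k 2 ≤ n k * h k 2 := Nat.mul_le_mul_right _ (by omega)
  have g4 : n k ≤ n k * h k 2 := Nat.le_mul_of_pos_right _ p2
  have comb := fun N' => exists_combination (m := m k) (n := n k) (N := N') hcop p1 p2
    (show h k 2 ≤ m k by omega) (by omega)
  have hc := mul_comm (h k 2) (h k 1)
  rcases le_or_gt (h k 1 * h k 2 + h k 2 + s + h k 2 * h k 1)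
    (n k * h k 2 + (m k + 2) * h k 1) with hs | hs
  · obtain ⟨i, j, hi, hi', hj, hj', e⟩ := comb (h k 1 * h k 2 + h k 2 + s) (by omega) hs
    have := K.exists_hit_same ht hi hi' hj'
    rwa [← e, show t * h (k + 1) 1 + (h k 1 * h k 2 + h k 2 + s) = N by omega] at this
  · simp only [add_mul, one_mul, mul_assoc] at g3 hs e1 e2 g1 g2
    obtain ⟨i, j, hi, hi', hj, hj', e⟩ :=
      comb (h k 1 * h k 2 + h k 2 + s - h (k + 1) 2) (by omega) (by
        simp only [add_mul]; omega)
    have := K.exists_hit_diff ht hi hi' hj hj'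
    rwa [← e, show t * h (k + 1) 1 + h (k + 1) 2 +
      (h k 1 * h k 2 + h k 2 + s - h (k + 1) 2) = N by omega] at this

theorem exists_hit (K : IsKeaneTower T m n h l a b) (N : ℕ) : ∀ k,
    h k 1 * h k 2 + h k 2 ≤ N →
    ∃ x ∈ base (a k) (b k) (l k) 1, T^[N] x ∈ base (a k) (b k) (l k) 2 := by
  induction N using Nat.strong_induction_on with
  | _ N ih =>
    intro k hN
    rcases lt_or_ge N (h k 1 * h k 2 + h k 2 + (m (k + 1) + 1) * h (k + 1) 1) with hlt | hge
    · exact K.exists_hit_initial hN hlt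
    have p0 := (K.good k).pos 0
    have p1 := (K.good (k + 1)).pos 1
    have e2 := K.time_two k
    have hm := (K.good (k + 1)).second_large
    have g1 : m (k + 1) ≤ m (k + 1) * h (k + 1) 1 := Nat.le_mul_of_pos_right _ p1
    have g2 : (m (k + 1) + 1) * h (k + 1) 1 = m (k + 1) * h (k + 1) 1 + h (k + 1) 1 :=
      Nat.succ_mul _ _
    have hNk : h (k + 1) 1 * h (k + 1) 2 + h (k + 1) 2 + h k 0 ≤ N := by
      have : h k 0 ≤ h (k + 1) 2 := by omega
      have := Nat.le_mul_of_pos_left (h (k + 1) 2) p1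
      omega
    obtain ⟨x, hx, hx'⟩ := ih (N - h k 0) (by omega) (k + 1) (by omega)
    refine ⟨_, K.iterate_mem_one (s := 0) (.inr ⟨rfl, by omega⟩) hx, ?_⟩
    have h3 := K.iterate_mem_two (i := 2) (j := 0) (K.third_pos k) hx'
    rw [← Function.iterate_add_apply] at h3 ⊢
    convert h3 using 2
    simp only [prefixTime, Matrix.cons_val]
    omega

theorem exists_visit (K : IsKeaneTower T m n h l a b) (k : ℕ) (i j : Fin 4) :
    ∃ r, ∀ x ∈ base (a (k + 2)) (b (k + 2)) (l (k + 2)) j,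
      T^[r] x ∈ base (a k) (b k) (l k) i := by
  have hthird : ∀ k j, 0 < thirdVisits (n k) j := fun k j => by
    have := K.third_pos k
    fin_cases j <;> simp [thirdVisits, this]
  have hsecond := K.second_pos
  have hlow : ∃ e : Fin 4, (e = 0 ∨ e = 1) ∧ ∃ r,
      ∀ x ∈ base (a (k + 2)) (b (k + 2)) (l (k + 2)) j,
        T^[r] x ∈ base (a (k + 1)) (b (k + 1)) (l (k + 1)) e := by
    by_cases hj : j = 2 ∨ j = 3
    · exact ⟨0, .inl rfl, _, fun x hx => K.iterate_mem_zero hj hx⟩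
    · refine ⟨1, .inr rfl, _, fun x hx => K.iterate_mem_one (s := 0) ?_ hx⟩
      have := hsecond (k + 1)
      fin_cases j <;> simp_all
  obtain ⟨e, he, r, hr⟩ := hlow
  match i with
  | 0 =>
    refine ⟨h k 3 + (prefixTime (m (k + 1)) (h (k + 1)) j + 0 * h (k + 1) 2), fun x hx => ?_⟩
    rw [Function.iterate_add_apply]
    exact K.iterate_mem_zero (.inl rfl) (K.iterate_mem_two (hthird _ _) hx)
  | 1 =>
    refine ⟨h k 3 + 0 * h k 1 + r, fun x hx => ?_⟩
    rw [Function.iterate_add_apply]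
    refine K.iterate_mem_one (i := e) ?_ (hr x hx)
    have := hsecond k
    rcases he with rfl | rfl <;> simp [this]
  | 2 =>
    refine ⟨prefixTime (m k) (h k) e + 0 * h k 2 + r, fun x hx => ?_⟩
    rw [Function.iterate_add_apply]
    exact K.iterate_mem_two (hthird _ _) (hr x hx)
  | 3 => exact ⟨r, fun x hx => K.mem_base_three (hr x hx)⟩

theorem dist_iterate_le (K : IsKeaneTower T m n h l a b) {k : ℕ} {i : Fin 4} {x y : ℝ} {s : ℕ}
    (hx : x ∈ base (a k) (b k) (l k) i) (hy : y ∈ base (a k) (b k) (l k) i) (hs : s ≤ h k i) :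
    |T^[s] x - T^[s] y| ≤ (1 / 2) ^ k := by
  obtain ⟨u, hu, rfl⟩ := hx
  obtain ⟨v, hv, rfl⟩ := hy
  rw [((K.renorm k).move i u v hu hv).1 s hs]
  have hu' := (hu.mem_total (K.len_pos k)).bounds
  have hv' := (hv.mem_total (K.len_pos k)).bounds
  have : chart (a k) (b k) u - chart (a k) (b k) v = sideSign (b k) * (u - v) := by
    simp only [chart]; ring
  rw [this, abs_mul, abs_sideSign, one_mul, abs_le]
  have := K.len_le k
  constructor <;> linarith [hu'.1, hu'.2, hv'.1, hv'.2]

theorem exists_floor_subset (K : IsKeaneTower T m n h l a b) {U : Set ℝ} (hU : IsOpen U)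
    (hne : (U ∩ Set.Ico 0 1).Nonempty) : ∃ k₀, ∀ k ≥ k₀, ∀ j, ∃ r,
      ∀ x ∈ base (a (k + 2)) (b (k + 2)) (l (k + 2)) j, T^[r] x ∈ U := by
  obtain ⟨z, hzU, hz⟩ := hne
  obtain ⟨ε, hε, hball⟩ := Metric.isOpen_iff.mp hU z hzU
  obtain ⟨k₀, hk₀⟩ := exists_pow_lt_of_lt_one hε (show (1 / 2 : ℝ) < 1 by norm_num)
  refine ⟨k₀, fun k hk j => ?_⟩
  obtain ⟨i, u, s, hu, hs, rfl⟩ := (K.renorm k).cover z hz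
  obtain ⟨r, hr⟩ := K.exists_visit k i j
  refine ⟨s + r, fun x hx => hball ?_⟩
  rw [Function.iterate_add_apply, Metric.mem_ball, Real.dist_eq]
  refine (K.dist_iterate_le (hr x hx) ⟨u, hu, rfl⟩ hs.le).trans_lt (lt_of_le_of_lt ?_ hk₀)
  exact pow_le_pow_of_le_one (by norm_num) (by norm_num) hk

theorem topMixingOn (K : IsKeaneTower T m n h l a b) : TopMixingOn T (Set.Ico 0 1) := by
  intro U V hU hV hUne hVne
  obtain ⟨k₁, h₁⟩ := K.exists_floor_subset hU hUne
  obtain ⟨k₂, h₂⟩ := K.exists_floor_subset hV hVne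
  obtain ⟨p, hp⟩ := h₁ (max k₁ k₂) (le_max_left _ _) 1
  obtain ⟨q, hq⟩ := h₂ (max k₁ k₂) (le_max_right _ _) 2
  set k := max k₁ k₂ + 2
  refine ⟨h k 1 * h k 2 + h k 2 + q, fun N hN => ?_⟩
  obtain ⟨x, hx, hx'⟩ := K.exists_hit (N + p - q) k (by omega)
  have hX := K.base_subset _ _ hx
  refine ⟨T^[N] (T^[p] x), ⟨_, ⟨hp x hx, K.mapsTo.iterate p hX⟩, rfl⟩, ?_,
    K.mapsTo.iterate N (K.mapsTo.iterate p hX)⟩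
  have := hq _ hx'
  rw [← Function.iterate_add_apply] at this ⊢
  convert this using 2
  omega

end IsKeaneTower

theorem MemPiece.add_shiftCoord {b : Bool} {l : Fin 4 → ℝ} (hl : ∀ i, 0 < l i) {i : Fin 4}
    {u : ℝ} (hu : MemPiece b l i u) : MemSided b 0 (totalLen l) (u + shiftCoord l i) := by
  have h0 := hl 0; have h1 := hl 1; have h2 := hl 2; have h3 := hl 3
  refine (MemSided.add hu (shiftCoord l i)).mono ?_ ?_ <;> fin_cases i <;>
    simp [startCoord, shiftCoord, totalLen] <;> linarith

theorem mem_base_iff {a : ℝ} {b : Bool} {l : Fin 4 → ℝ} {i : Fin 4} {x : ℝ} :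
    x ∈ base a b l i ↔ MemPiece b l i (sideSign b * (x - a)) := by
  have hs : sideSign b * sideSign b = 1 := by cases b <;> simp [sideSign]
  constructor
  · rintro ⟨u, hu, rfl⟩
    rwa [chart, add_sub_cancel_left, ← mul_assoc, hs, one_mul]
  · intro h
    refine ⟨_, h, ?_⟩
    rw [chart, ← mul_assoc, hs, one_mul, add_sub_cancel]

theorem measurableSet_base (a : ℝ) (b : Bool) (l : Fin 4 → ℝ) (i : Fin 4) :
    MeasurableSet (base a b l i) := by
  have : base a b l i = (fun x => sideSign b * (x - a)) ⁻¹' {u | MemPiece b l i u} := by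
    ext x; exact mem_base_iff
  rw [this]
  refine MeasurableSet.preimage ?_ (by fun_prop)
  cases b
  · have : {u | MemPiece false l i u} = Set.Ioc (startCoord l i) (startCoord l i + l i) := by
      ext; simp [MemPiece, MemSided]
    exact this ▸ measurableSet_Ioc
  · exact measurableSet_memPiece i

theorem abs_sum_range_sub_sum_range_le {F F' G : ℕ → ℝ} {s c : ℕ} {ω : ℝ}
    (hF : ∀ q < s + c, |F q - G q| ≤ ω) (hF' : ∀ q < s + c, |F' q - G q| ≤ ω)
    (hs : ∀ q, F (s + c + q) = F' q) :
    |∑ q ∈ range (s + c), F (q + s) - ∑ q ∈ range (s + c), G q| ≤ (s + c : ℕ) * ω := by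
  have e1 : ∑ q ∈ range (s + c), F (q + s) =
      ∑ q ∈ range c, F (s + q) + ∑ q ∈ range s, F' q := by
    rw [add_comm s c, sum_range_add]
    congr 1 <;> refine sum_congr rfl fun q _ => ?_
    · rw [add_comm]
    · rw [← hs]; congr 1; ring
  have e2 : ∑ q ∈ range c, F (s + q) + ∑ q ∈ range s, F' q -
      (∑ q ∈ range s, G q + ∑ q ∈ range c, G (s + q)) =
      ∑ q ∈ range s, (F' q - G q) + ∑ q ∈ range c, (F (s + q) - G (s + q)) := by
    rw [sum_sub_distrib, sum_sub_distrib]; ring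
  rw [e1, sum_range_add G, e2]
  refine (abs_add_le _ _).trans ?_
  push_cast
  rw [add_mul]
  gcongr
  · refine (abs_sum_le_sum_abs _ _).trans ((sum_le_card_nsmul _ _ ω fun q hq => ?_).trans ?_)
    · exact hF' q (by have := mem_range.mp hq; omega)
    · simp
  · refine (abs_sum_le_sum_abs _ _).trans ((sum_le_card_nsmul _ _ ω fun q hq => ?_).trans ?_)
    · exact hF _ (by have := mem_range.mp hq; omega)
    · simp

namespace IsKeaneTower

variable {T : ℝ → ℝ} {m n : ℕ → ℕ} {h : ℕ → Fin 4 → ℕ} {l : ℕ → Fin 4 → ℝ}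
    {a : ℕ → ℝ} {b : ℕ → Bool}

theorem iterate_time_mem_base_three (K : IsKeaneTower T m n h l a b) {k : ℕ} {i : Fin 4} {x : ℝ}
    (hx : x ∈ base (a (k + 1)) (b (k + 1)) (l (k + 1)) i) :
    T^[h (k + 1) i] x ∈ base (a k) (b k) (l k) 3 := by
  obtain ⟨u, hu, rfl⟩ := hx
  rw [((K.renorm (k + 1)).move i u u hu hu).2.1]
  obtain ⟨j, hj⟩ := exists_memPiece (hu.add_shiftCoord (K.len_pos (k + 1)))
  exact K.mem_base_three ⟨_, hj, rfl⟩

theorem third_mul_le (K : IsKeaneTower T m n h l a b) (k : ℕ) : n k * l k 3 ≤ l k 2 := by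
  rw [(K.step k).2.2.1, (K.step k).2.2.2]
  linarith [K.len_pos (k + 1) 0, K.len_pos (k + 1) 1, K.len_pos (k + 1) 3]

theorem exists_coord_of_iterate_mem (K : IsKeaneTower T m n h l a b) {k j : ℕ} (hj : j ≤ n k)
    {x : ℝ} (hx : x ∈ Set.Ico (0 : ℝ) 1) (hT : T^[j * h k 2] x ∈ base (a k) (b k) (l k) 3) :
    ∃ v, MemPiece (b k) (l k) 3 v ∧ x = chart (a k) (b k) (v - j * l k 3) := by
  obtain ⟨v, hv, he⟩ := hT
  refine ⟨v, hv, ?_⟩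
  have h3 := K.len_pos k 3
  have hmem : ∀ r < j, MemPiece (b k) (l k) 2 (v - j * l k 3 + r * shiftCoord (l k) 2) := by
    intro r hr
    have hn := K.third_mul_le k
    have h1 : (j : ℝ) * l k 3 ≤ n k * l k 3 := by gcongr
    have h2 : ((r : ℝ) + 1) * l k 3 ≤ j * l k 3 := by
      gcongr
      exact_mod_cast hr
    have h4 : (0 : ℝ) ≤ r * l k 3 := by positivity
    have e : v - j * l k 3 + r * shiftCoord (l k) 2 = v + (r * l k 3 - j * l k 3) := by
      simp [shiftCoord]; ring
    rw [e]
    refine (MemSided.add hv _).mono ?_ ?_ <;> simp [startCoord] <;> linarith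
  have hbase : chart (a k) (b k) (v - j * l k 3) ∈ Set.Ico (0 : ℝ) 1 := by
    rcases Nat.eq_zero_or_pos j with rfl | hj0
    · exact K.base_subset k 3 ⟨v, hv, by simp⟩
    · exact K.base_subset k 2 ⟨_, by simpa using hmem 0 hj0, rfl⟩
  refine K.injOn.iterate K.mapsTo (j * h k 2) hx hbase ?_
  rw [he, ((K.renorm k).move_iterate 2 _ _ j hmem hmem).2.1]
  congr 1
  simp [shiftCoord]

theorem iterate_mem_disjoint (K : IsKeaneTower T m n h l a b) {k i j : ℕ} (hi : i ≤ n k)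
    (hj : j ≤ n k) {x : ℝ} (hx : x ∈ Set.Ico (0 : ℝ) 1)
    (hTi : T^[i * h k 2] x ∈ base (a k) (b k) (l k) 3)
    (hTj : T^[j * h k 2] x ∈ base (a k) (b k) (l k) 3) : i = j := by
  obtain ⟨v, hv, rfl⟩ := K.exists_coord_of_iterate_mem hi hx hTi
  obtain ⟨w, hw, he⟩ := K.exists_coord_of_iterate_mem hj hx hTj
  have he' := chart_injective _ _ he
  have h3 := K.len_pos k 3
  have key : ∀ (p q : ℕ) (v w : ℝ), MemPiece (b k) (l k) 3 v → MemPiece (b k) (l k) 3 w →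
      v - p * l k 3 = w - q * l k 3 → p ≤ q := by
    intro p q v w hv hw hvw
    have hd := MemSided.disjoint (MemSided.add hw (p * l k 3 - q * l k 3))
      (by rwa [show w + (p * l k 3 - q * l k 3) = v by linarith])
    by_contra! hlt
    have : ((q : ℝ) + 1) * l k 3 ≤ p * l k 3 := by
      gcongr
      exact_mod_cast hlt
    linarith
  exact le_antisymm (key _ _ _ _ hv hw he') (key _ _ _ _ hw hv he'.symm)

variable {μ : Measure ℝ} [IsProbabilityMeasure μ]

theorem measureReal_base_three_le (K : IsKeaneTower T m n h l a b)
    (hT : MeasurePreserving T μ μ) (hμ : ∀ᵐ x ∂μ, x ∈ Set.Ico (0 : ℝ) 1) (k : ℕ) :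
    (n k + 1) * μ.real (base (a k) (b k) (l k) 3) ≤ 1 := by
  set J := base (a k) (b k) (l k) 3
  have hJ : MeasurableSet J := measurableSet_base _ _ _ _
  let A : ℕ → Set ℝ := fun j => T^[j * h k 2] ⁻¹' J ∩ Set.Ico 0 1
  have hA : ∀ j, MeasurableSet (A j) := fun j =>
    (hJ.preimage (hT.iterate _).measurable).inter measurableSet_Ico
  have hmA : ∀ j, μ.real (A j) = μ.real J := fun j => by
    rw [← (hT.iterate (j * h k 2)).measureReal_preimage hJ.nullMeasurableSet]
    refine measureReal_congr ?_
    filter_upwards [hμ] with x hx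
    exact propext ⟨fun hxA => hxA.1, fun hxJ => ⟨hxJ, hx⟩⟩
  have hdisj : ((range (n k + 1) : Finset ℕ) : Set ℕ).PairwiseDisjoint A := by
    intro i hi j hj hij
    refine Set.disjoint_left.mpr fun x hx hx' => hij ?_
    simp only [coe_range, Set.mem_Iio] at hi hj
    exact K.iterate_mem_disjoint (by omega) (by omega) hx.2 hx.1 hx'.1
  have hsum := measureReal_biUnion_finset (μ := μ) hdisj fun j _ => hA j
  simp only [hmA, sum_const, card_range, nsmul_eq_mul] at hsum
  push_cast at hsum
  rw [← hsum]
  exact measureReal_le_one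

/-- Time after which the orbit of every point whose orbit avoids the fourth interval is in a
long run of visits to the third interval. -/
def delay (m : ℕ) (h : Fin 4 → ℕ) : ℕ := h 3 + h 0 + (m + 1) * h 1

theorem prefixTime_le_delay (m : ℕ) (h : Fin 4 → ℕ) (i : Fin 4) :
    prefixTime m h i ≤ delay m h := by
  have : m * h 1 ≤ (m + 1) * h 1 := Nat.mul_le_mul_right _ (by omega)
  fin_cases i <;> (simp [prefixTime, delay]; try omega)

/-- Points visiting the fourth interval too early. -/
def earlySet (T : ℝ → ℝ) (N : ℕ) (J : Set ℝ) : Set ℝ :=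
  ⋃ s ∈ range (N + 1), T^[s] ⁻¹' J

theorem measurableSet_earlySet (hT : Measurable T) (N : ℕ) {J : Set ℝ} (hJ : MeasurableSet J) :
    MeasurableSet (earlySet T N J) :=
  Finset.measurableSet_biUnion _ fun s _ => hJ.preimage (hT.iterate s)

theorem measureReal_earlySet_le (K : IsKeaneTower T m n h l a b)
    (hT : MeasurePreserving T μ μ) (hμ : ∀ᵐ x ∂μ, x ∈ Set.Ico (0 : ℝ) 1) (k : ℕ) :
    μ.real (earlySet T (delay (m k) (h k) + h k 2) (base (a k) (b k) (l k) 3)) ≤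
      1 / (k + 1) := by
  have hJ := measurableSet_base (a k) (b k) (l k) 3
  have h1 := measureReal_biUnion_finset_le (μ := μ)
    (range (delay (m k) (h k) + h k 2 + 1)) fun s => T^[s] ⁻¹' (base (a k) (b k) (l k) 3)
  simp only [fun s => (hT.iterate s).measureReal_preimage hJ.nullMeasurableSet, sum_const,
    card_range, nsmul_eq_mul] at h1
  have h2 := K.measureReal_base_three_le hT hμ k
  have h3 : (k + 1) * (delay (m k) (h k) + h k 2 + 1) ≤ n k + 1 := by
    have := (K.good k).third_large
    simp only [delay]; omega
  have h3' : ((k : ℝ) + 1) * ((delay (m k) (h k) + h k 2 + 1 : ℕ) : ℝ) ≤ n k + 1 := by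
    exact_mod_cast h3
  rw [le_div_iff₀ (by positivity)]
  calc μ.real (earlySet T _ _) * (k + 1)
      ≤ ((delay (m k) (h k) + h k 2 + 1 : ℕ) : ℝ) * μ.real (base (a k) (b k) (l k) 3) *
        (k + 1) := by gcongr; exact h1
    _ = ((k : ℝ) + 1) * ((delay (m k) (h k) + h k 2 + 1 : ℕ) : ℝ) *
        μ.real (base (a k) (b k) (l k) 3) := by ring
    _ ≤ (n k + 1) * μ.real (base (a k) (b k) (l k) 3) := by gcongr
    _ ≤ 1 := h2

theorem exists_mem_two_of_notMem_earlySet (K : IsKeaneTower T m n h l a b) {k : ℕ} {x : ℝ}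
    (hx : x ∈ Set.Ico (0 : ℝ) 1)
    (hE : x ∉ earlySet T (delay (m k) (h k) + h k 2) (base (a k) (b k) (l k) 3)) :
    ∃ y ∈ base (a k) (b k) (l k) 2, T^[h k 2] y ∈ base (a k) (b k) (l k) 2 ∧
      ∃ s < h k 2, T^[delay (m k) (h k)] x = T^[s] y := by
  obtain ⟨i, u, s, hu, hs, rfl⟩ := (K.renorm (k + 1)).cover x hx
  set z := chart (a (k + 1)) (b (k + 1)) u
  have hz : z ∈ base (a (k + 1)) (b (k + 1)) (l (k + 1)) i := ⟨u, hu, rfl⟩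
  have hlate : s + (delay (m k) (h k) + h k 2) < h (k + 1) i := by
    by_contra hc
    refine hE (Set.mem_biUnion (x := h (k + 1) i - s) ?_ ?_)
    · exact mem_coe.mpr (mem_range.mpr (by omega))
    · rw [Set.mem_preimage, ← Function.iterate_add_apply, Nat.sub_add_cancel hs.le]
      exact K.iterate_time_mem_base_three hz
  have hP := prefixTime_le_delay (m k) (h k) i
  obtain ⟨r, hr⟩ := Nat.exists_eq_add_of_le (hP.trans (Nat.le_add_left _ s))
  rw [K.time_succ] at hlate
  simp only [nextTime] at hlate
  have hpos := (K.good k).pos 2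
  have hdiv := Nat.div_add_mod' r (h k 2)
  have hj : r / h k 2 + 1 < thirdVisits (n k) i := by
    refine lt_of_mul_lt_mul_right (a := h k 2) ?_ (Nat.zero_le _)
    rw [add_mul, one_mul]
    omega
  refine ⟨_, K.iterate_mem_two (j := r / h k 2) (by omega) hz, ?_, r % h k 2,
    Nat.mod_lt _ hpos, ?_⟩
  · have := K.iterate_mem_two hj hz
    rw [← Function.iterate_add_apply]
    convert this using 2
    ring
  · rw [← Function.iterate_add_apply, ← Function.iterate_add_apply]
    refine congrArg (fun N => T^[N] z) ?_
    omega

theorem abs_birkhoffSum_sub_le (K : IsKeaneTower T m n h l a b) {k : ℕ} {f : ℝ → ℝ} {ω : ℝ}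
    (hf : ∀ x ∈ Set.Ico (0 : ℝ) 1, ∀ y ∈ Set.Ico (0 : ℝ) 1, |x - y| ≤ (1 / 2) ^ k →
      |f x - f y| ≤ ω) {p x : ℝ} (hp : p ∈ base (a k) (b k) (l k) 2)
    (hx : x ∈ Set.Ico (0 : ℝ) 1)
    (hE : x ∉ earlySet T (delay (m k) (h k) + h k 2) (base (a k) (b k) (l k) 3)) :
    |∑ q ∈ range (h k 2), f (T^[q] (T^[delay (m k) (h k)] x)) -
      ∑ q ∈ range (h k 2), f (T^[q] p)| ≤ h k 2 * ω := by
  obtain ⟨y, hy, hy', s, hs, he⟩ := K.exists_mem_two_of_notMem_earlySet hx hE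
  obtain ⟨c, hc⟩ := Nat.exists_eq_add_of_le hs.le
  have close : ∀ y ∈ base (a k) (b k) (l k) 2, ∀ q < h k 2,
      |f (T^[q] y) - f (T^[q] p)| ≤ ω := fun y hy q hq =>
    hf _ (K.mapsTo.iterate q (K.base_subset k 2 hy)) _
      (K.mapsTo.iterate q (K.base_subset k 2 hp)) (K.dist_iterate_le hy hp hq.le)
  have := abs_sum_range_sub_sum_range_le (F := fun q => f (T^[q] y))
    (F' := fun q => f (T^[q] (T^[h k 2] y))) (G := fun q => f (T^[q] p)) (s := s) (c := c)
    (ω := ω) (by rw [← hc]; exact close y hy) (by rw [← hc]; exact close _ hy')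
    (fun q => by simp only [← hc, ← Function.iterate_add_apply, add_comm])
  rw [← hc] at this
  simpa only [he, ← Function.iterate_add_apply] using this

theorem abs_integral_sub_le (K : IsKeaneTower T m n h l a b)
    (hT : MeasurePreserving T μ μ) (hμ : ∀ᵐ x ∂μ, x ∈ Set.Ico (0 : ℝ) 1) {k : ℕ}
    (f : BoundedContinuousFunction ℝ ℝ) {ω : ℝ} (hω : 0 ≤ ω)
    (hf : ∀ x ∈ Set.Ico (0 : ℝ) 1, ∀ y ∈ Set.Ico (0 : ℝ) 1, |x - y| ≤ (1 / 2) ^ k →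
      |f x - f y| ≤ ω) {p : ℝ} (hp : p ∈ base (a k) (b k) (l k) 2) :
    |∫ x, f x ∂μ - (∑ q ∈ range (h k 2), f (T^[q] p)) / h k 2| ≤
      ω + 2 * ‖f‖ * (1 / (k + 1)) := by
  have hH : (0 : ℝ) < h k 2 := by exact_mod_cast (K.good k).pos 2
  set H := h k 2
  set d := delay (m k) (h k)
  set E := earlySet T (d + H) (base (a k) (b k) (l k) 3)
  have hE : MeasurableSet E := measurableSet_earlySet hT.measurable _ (measurableSet_base _ _ _ _)
  have hint : ∀ q, Integrable (fun x => f (T^[q] (T^[d] x))) μ := fun q =>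
    ((hT.iterate q).comp (hT.iterate d)).integrable_comp_of_integrable (f.integrable μ)
  have hval : ∀ q, ∫ x, f (T^[q] (T^[d] x)) ∂μ = ∫ x, f x ∂μ := fun q => by
    have hc := (hT.iterate q).comp (hT.iterate d)
    have := integral_map (μ := μ) (f := f) hc.measurable.aemeasurable
      f.continuous.aestronglyMeasurable
    rw [hc.map_eq] at this
    exact this.symm
  have hsum : ∫ x, (∑ q ∈ range H, f (T^[q] (T^[d] x)) - ∑ q ∈ range H, f (T^[q] p)) ∂μ =
      H * (∫ x, f x ∂μ - (∑ q ∈ range H, f (T^[q] p)) / H) := by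
    rw [integral_sub (integrable_finsetSum _ fun q _ => hint q) (integrable_const _),
      integral_finsetSum _ fun q _ => hint q]
    simp only [hval, sum_const, card_range, nsmul_eq_mul, integral_const, probReal_univ,
      one_smul]
    field_simp
  have hbound : ∀ᵐ x ∂μ,
      ‖∑ q ∈ range H, f (T^[q] (T^[d] x)) - ∑ q ∈ range H, f (T^[q] p)‖ ≤
        H * ω + H * (2 * ‖f‖) * E.indicator 1 x := by
    filter_upwards [hμ] with x hx
    by_cases hxE : x ∈ E
    · have h1 : ‖∑ q ∈ range H, f (T^[q] (T^[d] x)) - ∑ q ∈ range H, f (T^[q] p)‖ ≤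
          H * (2 * ‖f‖) := by
        rw [← sum_sub_distrib]
        refine (norm_sum_le_of_le _ fun q _ => (norm_sub_le _ _).trans
          (add_le_add (f.norm_coe_le_norm _) (f.norm_coe_le_norm _))).trans ?_
        simp only [sum_const, card_range, nsmul_eq_mul]
        rw [two_mul]
      have : (0 : ℝ) ≤ H * ω := by positivity
      simp only [hxE, Set.indicator_of_mem, Pi.one_apply, mul_one]
      linarith
    · simp only [hxE, not_false_eq_true, Set.indicator_of_notMem, mul_zero, add_zero]
      exact K.abs_birkhoffSum_sub_le hf hp hx hxE
  have hi : Integrable (fun x => E.indicator (1 : ℝ → ℝ) x) μ :=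
    (integrable_const (1 : ℝ)).indicator hE
  have hfin := norm_integral_le_of_norm_le
    ((integrable_const _).add (hi.const_mul _)) hbound
  rw [hsum, integral_add' (integrable_const _) (hi.const_mul _), integral_const,
    integral_const_mul, integral_indicator_one hE, probReal_univ, one_smul, Real.norm_eq_abs, abs_mul,
    abs_of_pos hH] at hfin
  have hEμ := K.measureReal_earlySet_le hT hμ k
  refine le_of_mul_le_mul_left (hfin.trans ?_) hH
  rw [mul_add, mul_assoc (H : ℝ) (2 * ‖f‖)]
  gcongr

theorem measure_eq (K : IsKeaneTower T m n h l a b) {ν : Measure ℝ} [IsProbabilityMeasure ν]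
    (hT : MeasurePreserving T μ μ) (hμ : ∀ᵐ x ∂μ, x ∈ Set.Ico (0 : ℝ) 1)
    (hT' : MeasurePreserving T ν ν) (hν : ∀ᵐ x ∂ν, x ∈ Set.Ico (0 : ℝ) 1) : μ = ν := by
  refine ext_of_forall_integral_eq_of_IsFiniteMeasure fun f => ?_
  refine eq_of_abs_sub_le_all fun ε hε => ?_
  have huc := isCompact_Icc.uniformContinuousOn_of_continuous
    (f.continuous.continuousOn (s := Set.Icc (0 : ℝ) 1))
  obtain ⟨δ, hδ, hfδ⟩ := Metric.uniformContinuousOn_iff.mp huc (ε / 4) (by positivity)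
  have hlim1 : ∀ᶠ k : ℕ in Filter.atTop, (1 / 2 : ℝ) ^ k < δ :=
    (tendsto_pow_atTop_nhds_zero_of_lt_one (by norm_num) (by norm_num)).eventually_lt_const hδ
  have hlim2 : ∀ᶠ k : ℕ in Filter.atTop, 2 * ‖f‖ * (1 / ((k : ℝ) + 1)) < ε / 4 := by
    have := (tendsto_one_div_add_atTop_nhds_zero_nat (𝕜 := ℝ)).const_mul (2 * ‖f‖)
    rw [mul_zero] at this
    exact this.eventually_lt_const (by positivity)
  obtain ⟨k, hk1, hk2⟩ := (hlim1.and hlim2).exists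
  have hf : ∀ x ∈ Set.Ico (0 : ℝ) 1, ∀ y ∈ Set.Ico (0 : ℝ) 1, |x - y| ≤ (1 / 2) ^ k →
      |f x - f y| ≤ ε / 4 := fun x hx y hy hxy =>
    (hfδ x (Set.Ico_subset_Icc_self hx) y (Set.Ico_subset_Icc_self hy)
      (by rw [Real.dist_eq]; linarith)).le
  obtain ⟨p, hp⟩ := base_nonempty (a := a k) (b := b k) (K.len_pos k) 2
  have h1 := abs_le.mp (K.abs_integral_sub_le hT hμ f (by positivity) hf hp)
  have h2 := abs_le.mp (K.abs_integral_sub_le hT' hν f (by positivity) hf hp)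
  rw [abs_le]
  constructor <;> linarith [h1.1, h1.2, h2.1, h2.2]

end IsKeaneTower

theorem isIrreducible_perm4213_symm : IsIrreducible perm4213.symm := by
  intro k hk0 hk4 h
  interval_cases k
  · have : perm4213.symm 0 ∈ {j : Fin 4 | (j : ℕ) < 1} := h ▸ Set.mem_image_of_mem _ (by simp)
    exact absurd this (by decide)
  · have : perm4213.symm 0 ∈ {j : Fin 4 | (j : ℕ) < 2} := h ▸ Set.mem_image_of_mem _ (by simp)
    exact absurd this (by decide)
  · have : perm4213.symm 2 ∈ {j : Fin 4 | (j : ℕ) < 3} := h ▸ Set.mem_image_of_mem _ (by simp)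
    exact absurd this (by decide)

/-- Side of the `k`-th inducing interval. -/
def towerSide : ℕ → Bool
  | 0 => true
  | k + 1 => !towerSide k

/-- Origin of the `k`-th inducing interval. -/
noncomputable def towerOrigin (l : ℕ → Fin 4 → ℝ) : ℕ → ℝ
  | 0 => 0
  | k + 1 => towerOrigin l k + sideSign (towerSide k) * totalLen (l k)

theorem exists_isKeaneTower : ∃ (m n : ℕ → ℕ) (h : ℕ → Fin 4 → ℕ) (l : ℕ → Fin 4 → ℝ),
    totalLen (l 0) = 1 ∧
      IsKeaneTower (keaneMap (l 0)) m n h l (towerOrigin l) towerSide := by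
  obtain ⟨m, n, h, h0, hsucc, hgood⟩ := exists_parameters
  have hn : ∀ k, 0 < n k := fun k => lt_of_lt_of_le (by omega) (hgood k).third_large
  have hm : ∀ k, 0 < m k := fun k => lt_of_lt_of_le (by omega) (hgood k).second_large
  obtain ⟨l, hl, h1, hstep⟩ := exists_lengths hm hn
  refine ⟨m, n, h, l, h1, ?_⟩
  have hrenorm : ∀ k, IsRenormalization (keaneMap (l 0)) (towerOrigin l k) (towerSide k)
      (l k) (h k) := by
    intro k
    induction k with
    | zero => rw [h0]; exact isRenormalization_keaneMap (hl 0) h1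
    | succ k ih => rw [hsucc]; exact ih.next (hstep k) (hl (k + 1))
  exact
    { len_pos := hl
      step := hstep
      time_succ := hsucc
      good := hgood
      renorm := hrenorm
      origin_succ := fun k => rfl
      side_succ := fun k => rfl
      len_le := totalLen_le_pow hn hl h1 hstep
      mapsTo := mapsTo_keaneMap (hl 0) h1
      injOn := injOn_keaneMap (hl 0) h1 }

theorem measurePreserving_of_measure_preimage {T : ℝ → ℝ} {μ : Measure ℝ} (hT : Measurable T)
    (h : ∀ s, MeasurableSet s → μ (T ⁻¹' s) = μ s) : MeasurePreserving T μ μ :=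
  ⟨hT, Measure.ext fun s hs => by rw [Measure.map_apply hT hs, h s hs]⟩

/-- There exist `d ≥ 2`, an irreducible permutation `π` of `{1,…,d}`
and a positive length vector `L` summing to `1` such that `T_{L,π} : [0,1) → [0,1)`
is topologically mixing and uniquely ergodic (exactly one invariant Borel
probability measure on `[0,1)`). -/
theorem exists_uniquely_ergodic_topologically_mixing_iet :
    ∃ (d : ℕ) (π : Equiv.Perm (Fin d)) (L : Fin d → ℝ), 2 ≤ d ∧
      IsIrreducible π ∧ (∀ i, 0 < L i) ∧ (∑ i, L i = 1) ∧
      TopMixingOn (ietMap π L) (Set.Ico (0 : ℝ) 1) ∧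
      (∃! μ : Measure ℝ, IsProbabilityMeasure μ ∧ μ (Set.Ico (0 : ℝ) 1)ᶜ = 0 ∧
        ∀ s : Set ℝ, MeasurableSet s → μ (ietMap π L ⁻¹' s) = μ s) := by
  obtain ⟨m, n, h, l, h1, K⟩ := exists_isKeaneTower
  have hprob : IsProbabilityMeasure (volume.restrict (Set.Ico (0 : ℝ) 1)) := ⟨by simp⟩
  have hnull : volume.restrict (Set.Ico (0 : ℝ) 1) (Set.Ico (0 : ℝ) 1)ᶜ = 0 := by
    rw [Measure.restrict_apply measurableSet_Ico.compl, Set.compl_inter_self, measure_empty]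
  have hinv : ∀ s : Set ℝ, MeasurableSet s →
      volume.restrict (Set.Ico (0 : ℝ) 1) (keaneMap (l 0) ⁻¹' s) =
        volume.restrict (Set.Ico (0 : ℝ) 1) s := fun s hs =>
    volume_restrict_keaneMap_preimage (K.len_pos 0) h1 hs
  have hmeas : Measurable (keaneMap (l 0)) := measurable_keaneMap (K.len_pos 0) h1
  refine ⟨4, perm4213.symm, l 0, by norm_num, isIrreducible_perm4213_symm, K.len_pos 0, ?_,
    K.topMixingOn, _, ⟨hprob, hnull, hinv⟩, ?_⟩
  · rw [Fin.sum_univ_four, ← h1, totalLen]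
  · rintro μ ⟨hμ, hμ0, hμT⟩
    exact K.measure_eq (measurePreserving_of_measure_preimage hmeas hμT) (mem_ae_iff.mpr hμ0)
      (measurePreserving_of_measure_preimage hmeas hinv) (mem_ae_iff.mpr hnull)

end IETPaper
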